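/- arXiv:1103.3732 — 3 statements merged into one kernel-verified Lean document; each statement's English description precedes it below -/
import Mathlib

section
/- A proper circular-arc (PCA) graph is a proper Helly circular-arc (PHCA) graph if and only if it contains no induced subgraph isomorphic to the 4-wheel W_4 and no induced subgraph isomorphic to the 3-sun S_3. -/
open Set

noncomputable section

instance : Fact ((0:ℝ) < 1) := ⟨one_pos⟩

/-- A point on the circle (of circumference 1). -/
abbrev Circ : Type := AddCircle (1 : ℝ)

/-- An arc of the circle, described by its beginning point `s` and its ending point `t`
(the arc is traversed clockwise, i.e. in the positive circular direction, from `s` to `t`). -/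
structure Arc where
  s : Circ
  t : Circ

/-- The set of points of the open arc: the points strictly between `s` and `t`
in the circular order. -/
def Arc.pts (A : Arc) : Set Circ := {x | sbtw A.s x A.t}

/-- The length of an arc: the representative in `(0, 1]` of `t - s`. -/
def Arc.length (A : Arc) : ℝ := ((AddCircle.equivIoc (1:ℝ) 0) (A.t - A.s) : ℝ)

/-- A circular-arc (CA) model: a finite family of arcs of the circle such that all
endpoints of the arcs are pairwise distinct (in particular each arc has two distinct
endpoints, hence no arc covers the whole circle). -/
structure CAModel (V : Type) [Fintype V] where
  arc : V → Arc
  endpoints_distinct : Function.Injective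
    (fun p : V × Bool => if p.2 then (arc p.1).s else (arc p.1).t)

namespace CAModel

variable {V : Type} [Fintype V]

/-- The arcs of `u` and `v` intersect. -/
def Inter (M : CAModel V) (u v : V) : Prop := ((M.arc u).pts ∩ (M.arc v).pts).Nonempty

/-- The intersection graph of the model: two distinct arcs are adjacent iff they have
nonempty intersection. -/
def interGraph (M : CAModel V) : SimpleGraph V :=
  SimpleGraph.fromRel fun u v => M.Inter u v

/-- `M` is a model of the graph `G`: the arcs are in correspondence with the vertices of `G`
and two vertices are adjacent iff their arcs are distinct and intersect. -/
def IsModelOf (M : CAModel V) (G : SimpleGraph V) : Prop :=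
  ∀ u v, G.Adj u v ↔ u ≠ v ∧ M.Inter u v

/-- Helly model: every subfamily of pairwise intersecting arcs has a common point. -/
def Helly (M : CAModel V) : Prop :=
  ∀ S : Set V, (∀ u ∈ S, ∀ v ∈ S, M.Inter u v) → ∃ p : Circ, ∀ v ∈ S, p ∈ (M.arc v).pts

/-- Normal model: no two arcs together cover the whole circle. -/
def Normal (M : CAModel V) : Prop :=
  ∀ u v : V, u ≠ v → (M.arc u).pts ∪ (M.arc v).pts ≠ Set.univ

/-- No three arcs together cover the whole circle. -/
def NoThreeCover (M : CAModel V) : Prop :=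
  ∀ u v w : V, u ≠ v → u ≠ w → v ≠ w →
    (M.arc u).pts ∪ (M.arc v).pts ∪ (M.arc w).pts ≠ Set.univ

/-- Proper model: no arc is properly contained in another arc. -/
def Proper (M : CAModel V) : Prop :=
  ∀ u v : V, u ≠ v → ¬ (M.arc u).pts ⊂ (M.arc v).pts

/-- Unit model: all arcs have the same length. -/
def IsUnit (M : CAModel V) : Prop :=
  ∀ u v : V, (M.arc u).length = (M.arc v).length

/-- Interval model: some point of the circle is covered by no arc. -/
def IsIntervalModel (M : CAModel V) : Prop :=
  ∃ p : Circ, ∀ v : V, p ∉ (M.arc v).pts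

/-- A universal arc: it intersects every other arc of the model. -/
def UniversalArc (M : CAModel V) (v : V) : Prop :=
  ∀ w, w ≠ v → M.Inter v w

end CAModel

section GraphClasses

variable {V : Type} [Fintype V]

def IsCAGraph (G : SimpleGraph V) : Prop := ∃ M : CAModel V, M.IsModelOf G
def IsHCAGraph (G : SimpleGraph V) : Prop := ∃ M : CAModel V, M.Helly ∧ M.IsModelOf G
def IsNCAGraph (G : SimpleGraph V) : Prop := ∃ M : CAModel V, M.Normal ∧ M.IsModelOf G
def IsNHCAGraph (G : SimpleGraph V) : Prop :=
  ∃ M : CAModel V, M.Normal ∧ M.Helly ∧ M.IsModelOf G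
def IsPCAGraph (G : SimpleGraph V) : Prop := ∃ M : CAModel V, M.Proper ∧ M.IsModelOf G
def IsNPCAGraph (G : SimpleGraph V) : Prop :=
  ∃ M : CAModel V, M.Normal ∧ M.Proper ∧ M.IsModelOf G
def IsPHCAGraph (G : SimpleGraph V) : Prop :=
  ∃ M : CAModel V, M.Proper ∧ M.Helly ∧ M.IsModelOf G
def IsUCAGraph (G : SimpleGraph V) : Prop := ∃ M : CAModel V, M.IsUnit ∧ M.IsModelOf G
def IsUHCAGraph (G : SimpleGraph V) : Prop :=
  ∃ M : CAModel V, M.IsUnit ∧ M.Helly ∧ M.IsModelOf G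
def IsIntervalGraph (G : SimpleGraph V) : Prop :=
  ∃ M : CAModel V, M.IsIntervalModel ∧ M.IsModelOf G

end GraphClasses
/-! ### Some small graphs -/

/-- The claw `K_{1,3}`: vertex `0` is adjacent to `1`, `2`, `3`, which are pairwise
non-adjacent. -/
def claw : SimpleGraph (Fin 4) := SimpleGraph.fromRel fun u _ => u = 0

/-- The `n`-wheel `W_n`: a chordless cycle on `n` vertices plus one extra vertex adjacent
to all of them (intended for `n ≥ 4`). -/
def wheel (n : ℕ) : SimpleGraph (Fin n ⊕ Unit) :=
  SimpleGraph.fromRel fun u v =>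
    (∃ x, u = Sum.inr x) ∨
    (∃ i j : Fin n, u = Sum.inl i ∧ v = Sum.inl j ∧ ((i : ℕ) + 1) % n = (j : ℕ))

/-- The 3-sun `S_3`: vertices `0,1,2` (the `v_i`'s) are pairwise adjacent, vertices
`3,4,5` (the `w_i`'s) are pairwise non-adjacent, and `w_i` is adjacent exactly to
`v_i` and `v_{i+1 (mod 3)}`. -/
def sun3 : SimpleGraph (Fin 6) :=
  SimpleGraph.fromRel fun u v =>
    ((u : ℕ) < 3 ∧ (v : ℕ) < 3) ∨
    (3 ≤ (u : ℕ) ∧ ((v : ℕ) = (u : ℕ) - 3 ∨ (v : ℕ) = ((u : ℕ) - 2) % 3))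

/-- The tent: the complement of the 3-sun. -/
def tent : SimpleGraph (Fin 6) := sun3ᶜ

/-- The `n`-rising sun `R_n` (intended for `n ≥ 4`): vertices `inl 0, …, inl (n-1)`
are `v_1, …, v_n` where `v_2, …, v_{n-1}` form a path in this order and `v_1`, `v_n`
are adjacent to all the `v`'s; `inr 0 = w_1` is adjacent exactly to `v_1, v_2`;
`inr 1 = w_{n-1}` is adjacent exactly to `v_{n-1}, v_n`; and `inr 2 = w_n` is adjacent
exactly to `v_n, v_1`. -/
def risingSun (n : ℕ) : SimpleGraph (Fin n ⊕ Fin 3) :=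
  SimpleGraph.fromRel fun u v =>
    match u, v with
    | Sum.inl a, Sum.inl b => (a : ℕ) = 0 ∨ (a : ℕ) = n - 1 ∨ (b : ℕ) = (a : ℕ) + 1
    | Sum.inr w, Sum.inl a =>
        ((w : ℕ) = 0 ∧ ((a : ℕ) = 0 ∨ (a : ℕ) = 1)) ∨
        ((w : ℕ) = 1 ∧ ((a : ℕ) = n - 2 ∨ (a : ℕ) = n - 1)) ∨
        ((w : ℕ) = 2 ∧ ((a : ℕ) = n - 1 ∨ (a : ℕ) = 0))
    | _, _ => False

/-- The umbrella: a path `0,1,2,3,4`, a vertex `5` adjacent to all of `0,…,4`, and a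
vertex `6` adjacent only to `2`. -/
def umbrella : SimpleGraph (Fin 7) :=
  SimpleGraph.fromRel fun u v =>
    ((u : ℕ) < 5 ∧ (v : ℕ) = (u : ℕ) + 1 ∧ (v : ℕ) < 5) ∨
    ((u : ℕ) = 5 ∧ (v : ℕ) < 5) ∨
    ((u : ℕ) = 6 ∧ (v : ℕ) = 2)

/-- cyclic strict betweenness on reals -/
def sb (a b c : ℝ) : Prop := (a < b ∧ b < c) ∨ (b < c ∧ c < a) ∨ (c < a ∧ a < b)

def co (x : Circ) : ℝ := ((AddCircle.equivIco (1:ℝ) 0) x : ℝ)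

lemma co_nonneg (x : Circ) : 0 ≤ co x := ((AddCircle.equivIco (1:ℝ) 0) x).2.1
lemma co_lt (x : Circ) : co x < 1 := by
  have := ((AddCircle.equivIco (1:ℝ) 0) x).2.2
  simpa [co] using this
lemma co_coe (x : Circ) : ((co x : ℝ) : Circ) = x := AddCircle.coe_equivIco
lemma co_inj {x y : Circ} (h : co x = co y) : x = y := by
  rw [← co_coe x, ← co_coe y, h]
lemma coe_co (r : ℝ) (h0 : 0 ≤ r) (h1 : r < 1) : co (r : Circ) = r := by
  unfold co
  have := AddCircle.equivIco_coe_eq (p := (1:ℝ)) (a := 0) (x := r) (by simp [h0, h1])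
  rw [this]

lemma sbtw_real (a b c : ℝ) (ha : 0 ≤ a) (ha' : a < 1) (hb : 0 ≤ b) (hb' : b < 1)
    (hc : 0 ≤ c) (hc' : c < 1) : sbtw (a : Circ) (b : Circ) (c : Circ) ↔ sb a b c := by
  rw [sbtw_iff_not_btw]
  have e1 : toIcoMod (one_pos : (0:ℝ) < 1) c b = if c ≤ b then b else b + 1 := by
    split_ifs with h
    · rw [toIcoMod_eq_iff]; exact ⟨⟨h, by linarith⟩, 0, by simp⟩
    · rw [toIcoMod_eq_iff]; exact ⟨⟨by linarith, by linarith⟩, -1, by simp⟩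
  have e2 : toIocMod (one_pos : (0:ℝ) < 1) c a = if c < a then a else a + 1 := by
    split_ifs with h
    · rw [toIocMod_eq_iff]; exact ⟨⟨h, by linarith⟩, 0, by simp⟩
    · rw [toIocMod_eq_iff]; exact ⟨⟨by linarith, by linarith⟩, -1, by simp⟩
  have : btw (c : Circ) (b : Circ) (a : Circ) ↔
      toIcoMod (one_pos : (0:ℝ) < 1) c b ≤ toIocMod (one_pos : (0:ℝ) < 1) c a :=
    QuotientAddGroup.btw_coe_iff
  rw [this, e1, e2, not_le]
  unfold sb
  split_ifs <;> constructor <;> intro h <;> grind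

lemma sbtw_co (a b c : Circ) : sbtw a b c ↔ sb (co a) (co b) (co c) := by
  have := sbtw_real (co a) (co b) (co c) (co_nonneg _) (co_lt _) (co_nonneg _) (co_lt _)
    (co_nonneg _) (co_lt _)
  rwa [co_coe, co_coe, co_coe] at this

lemma sbtw_sub (a b c p : Circ) : sbtw a b c ↔ sbtw (a - p) (b - p) (c - p) := by
  rw [sbtw_iff_not_btw, sbtw_iff_not_btw, not_iff_not]
  rw [← co_coe a, ← co_coe b, ← co_coe c, ← co_coe p]
  generalize co a = a; generalize co b = b; generalize co c = c; generalize co p = p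
  have h : ∀ x y z : ℝ, btw (x : Circ) (y : Circ) (z : Circ) ↔
      toIcoMod (one_pos : (0:ℝ) < 1) 0 (y - x) ≤ toIocMod (one_pos : (0:ℝ) < 1) 0 (z - x) :=
    fun x y z => QuotientAddGroup.btw_coe_iff'
  have h2 := h (c - p) (b - p) (a - p)
  rw [AddCircle.coe_sub, AddCircle.coe_sub, AddCircle.coe_sub] at h2
  rw [h, h2]; simp

def ko (p x : Circ) : ℝ := co (x - p)

lemma ko_self (p : Circ) : ko p p = 0 := by
  have := coe_co 0 le_rfl one_pos
  simpa [ko] using this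
lemma ko_nonneg (p x : Circ) : 0 ≤ ko p x := co_nonneg _
lemma ko_inj {p x y : Circ} (h : ko p x = ko p y) : x = y := by
  have := co_inj h; simpa using this
lemma sbtw_ko (p a b c : Circ) : sbtw a b c ↔ sb (ko p a) (ko p b) (ko p c) := by
  rw [sbtw_sub a b c p, sbtw_co]; rfl
lemma ko_pos {p x : Circ} (h : x ≠ p) : 0 < ko p x := by
  rcases (ko_nonneg p x).lt_or_eq with h1 | h1
  · exact h1
  · exact absurd (ko_inj (by rw [← h1, ko_self])) h

/-! order lemmas -/
lemma ord_inter {s1 t1 s2 t2 x : Circ} (h1 : sbtw s1 x t1) (h2 : sbtw s2 x t2) (h : s1 ≠ s2) :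
    sbtw s1 s2 t1 ∨ sbtw s2 s1 t2 := by
  have a := ko_self x
  have b1 := ko_pos (p := x) (x := s1) (by rintro rfl; exact (sbtw_irrefl_left h1))
  have b2 := ko_pos (p := x) (x := s2) (by rintro rfl; exact (sbtw_irrefl_left h2))
  have b3 : ko x s1 ≠ ko x s2 := fun e => h (ko_inj e)
  simp only [sbtw_ko x, sb] at *
  grind

lemma ord_cover2 {s1 t1 s2 t2 : Circ} (h1 : sbtw s1 s2 t1) (h2 : sbtw s2 s1 t2) (x : Circ) :
    sbtw s1 x t1 ∨ sbtw s2 x t2 := by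
  have a := ko_self s1
  have b1 := ko_nonneg s1 x
  simp only [sbtw_ko s1, sb] at *
  grind

lemma ord_cover3 {s1 t1 s2 t2 s3 t3 : Circ} (h1 : sbtw s2 s1 t2) (h2 : sbtw s3 s2 t3)
    (h3 : sbtw s1 s3 t1) (x : Circ) :
    sbtw s1 x t1 ∨ sbtw s2 x t2 ∨ sbtw s3 x t3 := by
  have a := ko_self s1
  have b1 := ko_nonneg s1 x
  have b2 := ko_nonneg s1 s2
  have b3 := ko_nonneg s1 s3
  have b4 := ko_nonneg s1 t1
  have b5 := ko_nonneg s1 t2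
  have b6 := ko_nonneg s1 t3
  simp only [sbtw_ko s1, sb] at *
  rw [a] at *
  generalize ko s1 x = x at *
  generalize ko s1 s2 = s2 at *
  generalize ko s1 s3 = s3 at *
  generalize ko s1 t1 = t1 at *
  generalize ko s1 t2 = t2 at *
  generalize ko s1 t3 = t3 at *
  grind

lemma ord_sub {su tu sv tv : Circ} (h1 : sbtw su sv tu) (h2 : ¬ sbtw sv su tv)
    (h3 : ¬ sbtw sv tu tv) (hne : sv ≠ tv) (hn1 : su ≠ tv) (hn2 : tu ≠ tv) (x : Circ)
    (hx : sbtw sv x tv) : sbtw su x tu := by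
  have a := ko_self su
  have b1 := ko_nonneg su x
  have b2 := ko_pos hn1.symm
  have b3 : ko su tu ≠ ko su tv := fun e => hn2 (ko_inj e)
  have b4 : ko su sv ≠ ko su tv := fun e => hne (ko_inj e)
  simp only [sbtw_ko su, sb] at *
  grind

/-- density: a point right after `a` avoiding finitely many points -/
lemma ord_dense (a : Circ) (F : Finset Circ) : ∃ x : Circ,
    ∀ s ∈ F, ∀ t ∈ F, (s = a ∨ sbtw s a t) → s ≠ t → sbtw s x t := by
  classical
  let T : Finset ℝ := insert 1 ((F.image (ko a)).filter (fun r => 0 < r))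
  have hT : T.Nonempty := ⟨1, by simp [T]⟩
  let m := T.min' hT
  have hm1 : m ≤ 1 := T.min'_le _ (by simp [T])
  have hm0 : 0 < m := by
    have := T.min'_mem hT
    simp only [T, Finset.mem_insert, Finset.mem_filter] at this
    rcases this with h | h
    · show 0 < T.min' hT
      rw [h]; exact one_pos
    · exact h.2
  have hF : ∀ s ∈ F, 0 < ko a s → m ≤ ko a s := fun s hs h =>
    T.min'_le _ (by simp only [T, Finset.mem_insert, Finset.mem_filter, Finset.mem_image]
                    exact Or.inr ⟨⟨s, hs, rfl⟩, h⟩)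
  have hx : ko a (((m / 2 : ℝ) : Circ) + a) = m / 2 := by
    unfold ko; rw [add_sub_cancel_right]; exact coe_co _ (by linarith) (by linarith)
  refine ⟨((m / 2 : ℝ) : Circ) + a, fun s hs t ht h hne => ?_⟩
  have e0 := ko_self a
  have e1 := hF s hs
  have e2 := hF t ht
  have e3 := ko_nonneg a s
  have e4 := ko_nonneg a t
  have e5 : ko a s ≠ ko a t := fun e => hne (ko_inj e)
  rw [sbtw_ko a, hx]
  rw [sbtw_ko a] at h
  have h' : ko a s = 0 ∨ sb (ko a s) (ko a a) (ko a t) := by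
    rcases h with rfl | h
    · exact Or.inl (ko_self _)
    · exact Or.inr h
  unfold sb at *
  grind

/-! model level -/
section ModelLevel
variable {V : Type} [Fintype V]

lemma s_ne_t (M : CAModel V) (u v : V) : (M.arc u).s ≠ (M.arc v).t := fun h => by
  have := @M.endpoints_distinct (u, true) (v, false) (by simpa using h)
  simp at this
lemma s_inj (M : CAModel V) {u v : V} (h : (M.arc u).s = (M.arc v).s) : u = v := by
  have := @M.endpoints_distinct (u, true) (v, true) (by simpa using h)
  simpa using this
lemma t_inj (M : CAModel V) {u v : V} (h : (M.arc u).t = (M.arc v).t) : u = v := by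
  have := @M.endpoints_distinct (u, false) (v, false) (by simpa using h)
  simpa using this

/-- `s(u)` lies in the arc of `v` -/
def Rl (M : CAModel V) (u v : V) : Prop := (M.arc u).s ∈ (M.arc v).pts

lemma Rl_irrefl (M : CAModel V) (u : V) : ¬ Rl M u u := fun h =>
  sbtw_irrefl_left (show sbtw (M.arc u).s (M.arc u).s (M.arc u).t from h)

lemma common_pt (M : CAModel V) (u : V) (S : Set V) (h : ∀ v ∈ S, v = u ∨ Rl M u v) :
    ∃ p, ∀ v ∈ S, p ∈ (M.arc v).pts := by
  classical
  obtain ⟨x, hx⟩ := ord_dense (M.arc u).s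
    (Finset.univ.image (fun v => (M.arc v).s) ∪ Finset.univ.image (fun v => (M.arc v).t))
  refine ⟨x, fun v hv => hx _ (by simp) _ (by simp) ?_ (s_ne_t M v v)⟩
  rcases h v hv with rfl | h
  · exact Or.inl rfl
  · exact Or.inr h

lemma inter_self (M : CAModel V) (u : V) : M.Inter u u := by
  obtain ⟨p, hp⟩ := common_pt M u {u} (by simp)
  exact ⟨p, hp u rfl, hp u rfl⟩

lemma inter_symm (M : CAModel V) {u v : V} (h : M.Inter u v) : M.Inter v u := by
  obtain ⟨p, h1, h2⟩ := h; exact ⟨p, h2, h1⟩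

lemma inter_of_Rl (M : CAModel V) {u v : V} (h : Rl M u v) : M.Inter u v := by
  obtain ⟨p, hp⟩ := common_pt M u {u, v} (by simp [h])
  exact ⟨p, hp u (by simp), hp v (by simp)⟩

lemma Rl_of_inter (M : CAModel V) {u v : V} (hne : u ≠ v) (h : M.Inter u v) :
    Rl M u v ∨ Rl M v u := by
  obtain ⟨x, h1, h2⟩ := h
  exact (ord_inter h1 h2 (fun e => hne (s_inj M e))).symm

lemma helly_of (M : CAModel V) (h2 : ∀ u v, Rl M u v → ¬ Rl M v u)
    (h3 : ∀ u v w, Rl M u v → Rl M v w → ¬ Rl M w u) : M.Helly := by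
  intro S hS
  rcases S.eq_empty_or_nonempty with rfl | ⟨a, ha⟩
  · exact ⟨0, by simp⟩
  let r : S → S → Prop := fun x y => Rl M x.1 y.1
  have tr : IsTrans S r := ⟨fun x y z hxy hyz => by
    by_cases e : x.1 = z.1
    · exact absurd (show Rl M y.1 x.1 by rw [e]; exact hyz) (h2 _ _ hxy)
    · rcases Rl_of_inter M e (hS _ x.2 _ z.2) with h | h
      · exact h
      · exact absurd h (h3 _ _ _ hxy hyz)⟩
  have irr : Std.Irrefl r := ⟨fun x => Rl_irrefl M x.1⟩
  have wf : WellFounded r := Finite.wellFounded_of_trans_of_irrefl r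
  obtain ⟨m, -, hm⟩ := wf.has_min Set.univ ⟨⟨a, ha⟩, trivial⟩
  refine common_pt M m.1 S fun v hv => ?_
  by_cases e : v = m.1
  · exact Or.inl e
  · right
    rcases Rl_of_inter M e (hS _ hv _ m.2) with h | h
    · exact absurd h (hm ⟨v, hv⟩ trivial)
    · exact h

/-- two arcs covering the circle in a proper model: both are universal -/
lemma univ_of_cover (M : CAModel V) (hP : M.Proper) {u v : V}
    (hc : ∀ x, x ∈ (M.arc u).pts ∨ x ∈ (M.arc v).pts) (w : V) : M.Inter w u := by
  by_contra hw
  have hwv : w ≠ v := by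
    rintro rfl
    rcases hc (M.arc u).s with h | h
    · exact Rl_irrefl M u h
    · exact hw (inter_symm M (inter_of_Rl M h))
  refine hP w v hwv ⟨fun x hx => ?_, fun hsub => ?_⟩
  · rcases hc x with h | h
    · exact absurd ⟨x, hx, h⟩ hw
    · exact h
  · rcases hc (M.arc u).s with h | h
    · exact Rl_irrefl M u h
    · exact hw (inter_symm M (inter_of_Rl M (hsub h)))

/-- three arcs in a cyclic position: an arc missing the first meets the second -/
lemma meets_second (M : CAModel V) (hP : M.Proper) {a b c : V} (h1 : Rl M a b) (h2 : Rl M b c)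
    (h3 : Rl M c a) {w : V} (hw : ¬ M.Inter w a) : M.Inter w b := by
  by_contra hb
  have hwc : w ≠ c := by
    rintro rfl; exact hw (inter_of_Rl M h3)
  refine hP w c hwc ⟨fun x hx => ?_, fun hsub => ?_⟩
  · rcases ord_cover3 h1 h2 h3 x with h | h | h
    · exact absurd ⟨x, hx, h⟩ hw
    · exact absurd ⟨x, hx, h⟩ hb
    · exact h
  · exact hb (inter_symm M (inter_of_Rl M (hsub h2)))

lemma meets_third (M : CAModel V) (hP : M.Proper) {a b c : V} (h1 : Rl M a b) (h2 : Rl M b c)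
    (h3 : Rl M c a) {w : V} (hw : ¬ M.Inter w a) : M.Inter w c := by
  by_contra hb
  have hwc : w ≠ b := by
    rintro rfl; exact hw (inter_symm M (inter_of_Rl M h1))
  refine hP w b hwc ⟨fun x hx => ?_, fun hsub => ?_⟩
  · rcases ord_cover3 h1 h2 h3 x with h | h | h
    · exact absurd ⟨x, hx, h⟩ hw
    · exact h
    · exact absurd ⟨x, hx, h⟩ hb
  · exact hw (inter_symm M (inter_of_Rl M (hsub h1)))

/-! graph-level embeddings -/
lemma mk_emb {W : Type} {H : SimpleGraph W} {G : SimpleGraph V} (hE : IsEmpty (H ↪g G))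
    (f : W → V) (hf : Function.Injective f) (h : ∀ i j, G.Adj (f i) (f j) ↔ H.Adj i j) : False :=
  hE.elim ⟨⟨f, hf⟩, fun {i j} => h i j⟩

lemma no_wheel {G : SimpleGraph V} (hW : IsEmpty (wheel 4 ↪g G)) {a b c d h : V}
    (ab : G.Adj a b) (bc : G.Adj b c) (cd : G.Adj c d) (da : G.Adj d a)
    (ac : ¬ G.Adj a c) (bd : ¬ G.Adj b d) (nac : a ≠ c) (nbd : b ≠ d)
    (ha : G.Adj h a) (hb : G.Adj h b) (hc : G.Adj h c) (hd : G.Adj h d) : False := by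
  have e1 := ab.ne; have e2 := bc.ne; have e3 := cd.ne; have e4 := da.ne
  have f1 := ha.ne; have f2 := hb.ne; have f3 := hc.ne; have f4 := hd.ne
  have ac' : ¬ G.Adj c a := fun h => ac h.symm
  have bd' : ¬ G.Adj d b := fun h => bd h.symm
  refine mk_emb hW (Sum.elim ![a, b, c, d] (fun _ => h)) ?_ ?_
  · rintro (i | i) (j | j) hij
    · fin_cases i <;> fin_cases j <;> simp_all
    · fin_cases i <;> simp_all
    · fin_cases j <;> simp_all
    · rfl
  · rintro (i | i) (j | j)
    · fin_cases i <;> fin_cases j <;> simp [wheel, *, ab.symm, bc.symm, cd.symm, da.symm]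
    · fin_cases i <;> simp [wheel, ha.symm, hb.symm, hc.symm, hd.symm]
    · fin_cases j <;> simp [wheel, *]
    · simp [wheel]

lemma no_sun {G : SimpleGraph V} (hS : IsEmpty (sun3 ↪g G)) {a b c x y z : V}
    (ab : G.Adj a b) (bc : G.Adj b c) (ca : G.Adj c a)
    (xa : G.Adj x a) (xb : G.Adj x b) (xc : ¬ G.Adj x c)
    (yb : G.Adj y b) (yc : G.Adj y c) (ya : ¬ G.Adj y a)
    (zc : G.Adj z c) (za : G.Adj z a) (zb : ¬ G.Adj z b)
    (xy : ¬ G.Adj x y) (yz : ¬ G.Adj y z) (zx : ¬ G.Adj z x) : False := by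
  have n1 := ab.ne; have n2 := bc.ne; have n3 := ca.ne
  have n4 := xa.ne; have n5 := xb.ne; have n6 := yb.ne; have n7 := yc.ne
  have n8 := zc.ne; have n9 := za.ne
  have m1 : x ≠ c := by rintro rfl; exact zx zc
  have m2 : y ≠ a := by rintro rfl; exact xy xa
  have m3 : z ≠ b := by rintro rfl; exact yz yb
  have m4 : x ≠ y := by rintro rfl; exact ya xa
  have m5 : y ≠ z := by rintro rfl; exact zb yb
  have m6 : z ≠ x := by rintro rfl; exact xc zc
  refine mk_emb hS ![a, b, c, x, y, z] ?_ ?_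
  · intro i j hij
    fin_cases i <;> fin_cases j <;> first
      | rfl
      | exfalso; first
        | exact n1 hij | exact n1 hij.symm
        | exact n2 hij | exact n2 hij.symm
        | exact n3 hij | exact n3 hij.symm
        | exact n4 hij | exact n4 hij.symm
        | exact n5 hij | exact n5 hij.symm
        | exact n6 hij | exact n6 hij.symm
        | exact n7 hij | exact n7 hij.symm
        | exact n8 hij | exact n8 hij.symm
        | exact n9 hij | exact n9 hij.symm
        | exact m1 hij | exact m1 hij.symm
        | exact m2 hij | exact m2 hij.symm
        | exact m3 hij | exact m3 hij.symm
        | exact m4 hij | exact m4 hij.symm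
        | exact m5 hij | exact m5 hij.symm
        | exact m6 hij | exact m6 hij.symm
  · intro i j
    fin_cases i <;> fin_cases j <;>
      simp [sun3, *, ab.symm, bc.symm, ca.symm, xa.symm, xb.symm, yb.symm, yc.symm, zc.symm,
        za.symm, G.adj_comm c x, G.adj_comm a y, G.adj_comm b z, G.adj_comm y x,
        G.adj_comm z y, G.adj_comm x z]

lemma case_no_univ {G : SimpleGraph V} (M : CAModel V) (hP : M.Proper) (hM : M.IsModelOf G)
    (hW : IsEmpty (wheel 4 ↪g G)) (hS : IsEmpty (sun3 ↪g G))
    (hU : ∀ u, ∃ w, ¬ M.Inter w u) : IsPHCAGraph G := by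
  have h2 : ∀ u v, Rl M u v → ¬ Rl M v u := by
    intro u v h h'
    obtain ⟨w, hw⟩ := hU u
    exact hw (univ_of_cover M hP (fun x => ord_cover2 h' h x) w)
  refine ⟨M, hP, helly_of M h2 ?_, hM⟩
  intro a b c h1 h2 h3
  obtain ⟨a', ha⟩ := hU a
  obtain ⟨b', hb⟩ := hU b
  obtain ⟨c', hc⟩ := hU c
  have iab := meets_second M hP h1 h2 h3 ha
  have iac := meets_third M hP h1 h2 h3 ha
  have ibc := meets_second M hP h2 h3 h1 hb
  have iba := meets_third M hP h2 h3 h1 hb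
  have ica := meets_second M hP h3 h1 h2 hc
  have icb := meets_third M hP h3 h1 h2 hc
  have jab := inter_of_Rl M h1
  have jbc := inter_of_Rl M h2
  have jca := inter_of_Rl M h3
  have adj : ∀ {u v}, u ≠ v → M.Inter u v → G.Adj u v := fun h h' => (hM _ _).2 ⟨h, h'⟩
  have nadj : ∀ {u v}, ¬ M.Inter u v → ¬ G.Adj u v := fun h h' => h ((hM _ _).1 h').2
  have ne : ∀ {u v w}, ¬ M.Inter u w → M.Inter v w → u ≠ v := by
    rintro u v w h h' rfl; exact h h'
  have Aab : G.Adj a b := adj (by rintro rfl; exact Rl_irrefl M _ h1) jab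
  have Abc : G.Adj b c := adj (by rintro rfl; exact Rl_irrefl M _ h2) jbc
  have Aca : G.Adj c a := adj (by rintro rfl; exact Rl_irrefl M _ h3) jca
  have Aa'b : G.Adj a' b := adj (ne ha (inter_symm M jab)) iab
  have Aa'c : G.Adj a' c := adj (ne ha jca) iac
  have Ab'c : G.Adj b' c := adj (ne hb (inter_symm M jbc)) ibc
  have Ab'a : G.Adj b' a := adj (ne hb jab) iba
  have Ac'a : G.Adj c' a := adj (ne hc (inter_symm M jca)) ica
  have Ac'b : G.Adj c' b := adj (ne hc jbc) icb
  have xab : ¬ M.Inter a' b' := fun h =>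
    no_wheel hW (a := a) (b := b) (c := a') (d := b') (h := c) Aab Aa'b.symm
      (adj (ne ha iba) h) Ab'a (fun h => nadj ha h.symm) (fun h => nadj hb h.symm)
      (ne ha (inter_self M a)).symm (ne hb (inter_self M b)).symm Aca Abc.symm Aa'c.symm Ab'c.symm
  have xbc : ¬ M.Inter b' c' := fun h =>
    no_wheel hW (a := b) (b := c) (c := b') (d := c') (h := a) Abc Ab'c.symm
      (adj (ne hb icb) h) Ac'b (fun h => nadj hb h.symm) (fun h => nadj hc h.symm)
      (ne hb (inter_self M b)).symm (ne hc (inter_self M c)).symm Aab Aca.symm Ab'a.symm Ac'a.symm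
  have xca : ¬ M.Inter c' a' := fun h =>
    no_wheel hW (a := c) (b := a) (c := c') (d := a') (h := b) Aca Ac'a.symm
      (adj (ne hc iac) h) Aa'c (fun h => nadj hc h.symm) (fun h => nadj ha h.symm)
      (ne hc (inter_self M c)).symm (ne ha (inter_self M a)).symm Abc Aab.symm Ac'b.symm Aa'b.symm
  exact no_sun hS (a := a) (b := b) (c := c) (x := c') (y := a') (z := b') Aab Abc Aca
    Ac'a Ac'b (nadj hc) Aa'b Aa'c (nadj ha) Ab'c Ab'a (nadj hb) (nadj xca) (nadj xab) (nadj xbc)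

end ModelLevel

section Forward
variable {V : Type} [Fintype V]

lemma ord_interval {s t a b p q y : Circ} (hp : sbtw s p t) (hq : sbtw s q t)
    (hap : sbtw a p b) (haq : sbtw a q b) (h1 : ko s p < ko s y) (h2 : ko s y < ko s q)
    (hy : ¬ sbtw a y b) (x : Circ) : sbtw s x t ∨ sbtw a x b := by
  have e := ko_self s
  have e1 := ko_nonneg s x
  have e2 := ko_nonneg s t
  have e3 := ko_nonneg s a
  have e4 := ko_nonneg s b
  simp only [sbtw_ko s, sb] at *
  rw [e] at *
  generalize ko s x = x at *
  generalize ko s t = t at *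
  generalize ko s a = a at *
  generalize ko s b = b at *
  generalize ko s p = p at *
  generalize ko s q = q at *
  generalize ko s y = y at *
  grind

lemma wheel_false (M : CAModel V) (hP : M.Proper) (hH : M.Helly) {a b c d h : V}
    (ab : M.Inter a b) (bc : M.Inter b c) (cd : M.Inter c d) (da : M.Inter d a)
    (ac : ¬ M.Inter a c) (bd : ¬ M.Inter b d)
    (ha : M.Inter h a) (hb : M.Inter h b) (hc : M.Inter h c) (hd : M.Inter h d) : False := by
  have tri : ∀ {u v : V}, M.Inter u v → M.Inter h u → M.Inter h v →
      ∃ p, p ∈ (M.arc h).pts ∧ p ∈ (M.arc u).pts ∧ p ∈ (M.arc v).pts := by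
    intro u v huv hu hv
    obtain ⟨p, hp⟩ := hH {h, u, v} (by
      have := inter_self M h; have := inter_self M u; have := inter_self M v
      have := inter_symm M huv; have := inter_symm M hu; have := inter_symm M hv
      simp only [Set.mem_insert_iff, Set.mem_singleton_iff]
      rintro x (rfl | rfl | rfl) y (rfl | rfl | rfl) <;> assumption)
    exact ⟨p, hp _ (by simp), hp _ (by simp), hp _ (by simp)⟩
  obtain ⟨p, hph, pa, pb⟩ := tri ab ha hb
  obtain ⟨q, hqh, qb, qc⟩ := tri bc hb hc
  obtain ⟨r, hrh, rc, rd⟩ := tri cd hc hd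
  obtain ⟨s, hsh, sd, sa⟩ := tri da hd ha
  have key : ∀ {u w : V} {x y z : Circ}, ¬ M.Inter u w → x ∈ (M.arc h).pts →
      y ∈ (M.arc h).pts → x ∈ (M.arc u).pts → y ∈ (M.arc u).pts → z ∈ (M.arc w).pts →
      ko (M.arc h).s x < ko (M.arc h).s z → ko (M.arc h).s z < ko (M.arc h).s y → False := by
    intro u w x y z huw hx hy ux uy wz h1 h2
    refine huw (inter_symm M (univ_of_cover M hP (v := h) (fun x' => ?_) w))
    exact (ord_interval hx hy ux uy h1 h2 (fun hz => huw ⟨z, hz, wz⟩) x').symm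
  have ca : ¬ M.Inter c a := fun h => ac (inter_symm M h)
  have db : ¬ M.Inter d b := fun h => bd (inter_symm M h)
  have ne : ∀ {u w : V} {x z : Circ}, ¬ M.Inter u w → x ∈ (M.arc u).pts → z ∈ (M.arc w).pts →
      ko (M.arc h).s x ≠ ko (M.arc h).s z := by
    intro u w x z huw hx hz e
    exact huw ⟨x, hx, (ko_inj e) ▸ hz⟩
  have a1 := @key a c s p q ac hsh hph sa pa qc
  have a2 := @key a c p s q ac hph hsh pa sa qc
  have a3 := @key a c s p r ac hsh hph sa pa rc
  have a4 := @key a c p s r ac hph hsh pa sa rc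
  have b1 := @key b d p q r bd hph hqh pb qb rd
  have b2 := @key b d q p r bd hqh hph qb pb rd
  have b3 := @key b d p q s bd hph hqh pb qb sd
  have b4 := @key b d q p s bd hqh hph qb pb sd
  have c1 := @key c a q r p ca hqh hrh qc rc pa
  have c2 := @key c a r q p ca hrh hqh rc qc pa
  have c3 := @key c a q r s ca hqh hrh qc rc sa
  have c4 := @key c a r q s ca hrh hqh rc qc sa
  have d1 := @key d b r s p db hrh hsh rd sd pb
  have d2 := @key d b s r p db hsh hrh sd rd pb
  have d3 := @key d b r s q db hrh hsh rd sd qb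
  have d4 := @key d b s r q db hsh hrh sd rd qb
  have n1 := ne ac pa qc
  have n2 := ne ac pa rc
  have n3 := ne ac sa qc
  have n4 := ne ac sa rc
  have n5 := ne bd pb sd
  have n6 := ne bd qb rd
  clear key ne tri
  generalize ko (M.arc h).s p = p at *
  generalize ko (M.arc h).s q = q at *
  generalize ko (M.arc h).s r = r at *
  generalize ko (M.arc h).s s = s at *
  clear pa pb qb qc rc rd sd sa hph hqh hrh hsh ab bc cd da ha hb hc hd
  grind

lemma ord_sun {a b c d p x y z : Circ} (h1 : sbtw a p b) (h2 : sbtw c p d)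
    (hx : ¬ sbtw a x b) (hy : sbtw a y b) (hz : ¬ sbtw c z d) (hy' : sbtw c y d)
    (hxy : ko p x < ko p y) (hyz : ko p y < ko p z) (w : Circ) :
    sbtw a w b ∨ sbtw c w d := by
  have e := ko_self p
  have e1 := ko_nonneg p x
  have e2 := ko_nonneg p w
  have e3 := ko_nonneg p a
  have e4 := ko_nonneg p b
  have e5 := ko_nonneg p c
  have e6 := ko_nonneg p d
  simp only [sbtw_ko p, sb] at *
  rw [e] at *
  generalize ko p x = x at *
  generalize ko p y = y at *
  generalize ko p z = z at *
  generalize ko p w = w at *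
  generalize ko p a = a at *
  generalize ko p b = b at *
  generalize ko p c = c at *
  generalize ko p d = d at *
  have k1 : b ≤ x ∧ x ≤ a := by grind
  have k2 : d ≤ z ∧ z ≤ c := by grind
  have k3 : a < y := by grind
  have k4 : y < d := by grind
  grind

lemma sun_false (M : CAModel V) (hP : M.Proper) (hH : M.Helly) {a b c x y z : V}
    (ab : M.Inter a b) (bc : M.Inter b c) (ca : M.Inter c a)
    (xa : M.Inter x a) (xb : M.Inter x b) (xc : ¬ M.Inter x c)
    (yb : M.Inter y b) (yc : M.Inter y c) (ya : ¬ M.Inter y a)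
    (zc : M.Inter z c) (za : M.Inter z a) (zb : ¬ M.Inter z b) : False := by
  have tri : ∀ {h u v : V}, M.Inter u v → M.Inter h u → M.Inter h v →
      ∃ p, p ∈ (M.arc h).pts ∧ p ∈ (M.arc u).pts ∧ p ∈ (M.arc v).pts := by
    intro h u v huv hu hv
    obtain ⟨p, hp⟩ := hH {h, u, v} (by
      have := inter_self M h; have := inter_self M u; have := inter_self M v
      have := inter_symm M huv; have := inter_symm M hu; have := inter_symm M hv
      simp only [Set.mem_insert_iff, Set.mem_singleton_iff]
      rintro x (rfl | rfl | rfl) y (rfl | rfl | rfl) <;> assumption)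
    exact ⟨p, hp _ (by simp), hp _ (by simp), hp _ (by simp)⟩
  obtain ⟨o, oa, ob, oc⟩ := tri bc ab (inter_symm M ca)
  obtain ⟨p, px, pa, pb⟩ := tri ab xa xb
  obtain ⟨q, qy, qb, qc⟩ := tri bc yb yc
  obtain ⟨r, rz, rc, ra⟩ := tri ca zc za
  -- `u` misses the smallest, `v` misses the largest
  have key : ∀ {u v w1 : V} {i j k : Circ}, ¬ M.Inter w1 u → o ∈ (M.arc u).pts →
      o ∈ (M.arc v).pts → i ∈ (M.arc w1).pts → k ∉ (M.arc v).pts →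
      j ∈ (M.arc u).pts → j ∈ (M.arc v).pts → ko o i < ko o j → ko o j < ko o k → False := by
    intro u v w1 i j k hw ou ov iw kv ju jv h1 h2
    refine hw (univ_of_cover M hP (v := v) (fun t => ?_) w1)
    exact ord_sun ou ov (fun h => hw ⟨i, iw, h⟩) ju kv jv h1 h2 t
  have np : p ∉ (M.arc c).pts := fun h => xc ⟨p, px, h⟩
  have nq : q ∉ (M.arc a).pts := fun h => ya ⟨q, qy, h⟩
  have nr : r ∉ (M.arc b).pts := fun h => zb ⟨r, rz, h⟩
  have npq : ko o p ≠ ko o q := fun e => np (ko_inj e ▸ qc)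
  have npr : ko o p ≠ ko o r := fun e => np (ko_inj e ▸ rc)
  have nqr : ko o q ≠ ko o r := fun e => nq (ko_inj e ▸ ra)
  rcases lt_or_gt_of_ne npq with h1 | h1 <;> rcases lt_or_gt_of_ne npr with h2 | h2 <;>
    rcases lt_or_gt_of_ne nqr with h3 | h3
  · exact key xc oc ob px nr qc qb h1 h3
  · exact key xc oc oa px nq rc ra h2 h3
  · linarith
  · exact key zb ob oa rz nq pb pa h2 h1
  · exact key ya oa ob qy nr pa pb h1 h2
  · linarith
  · exact key ya oa oc qy np ra rc h3 h2
  · exact key zb ob oc rz np qb qc h3 h1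

lemma forward {G : SimpleGraph V} (h : IsPHCAGraph G) :
    IsEmpty (wheel 4 ↪g G) ∧ IsEmpty (sun3 ↪g G) := by
  obtain ⟨M, hP, hH, hM⟩ := h
  constructor
  · refine ⟨fun f => ?_⟩
    have pos : ∀ i j, (wheel 4).Adj i j → M.Inter (f i) (f j) := fun i j h =>
      ((hM _ _).1 (f.map_adj_iff.2 h)).2
    have neg : ∀ i j, i ≠ j → ¬ (wheel 4).Adj i j → ¬ M.Inter (f i) (f j) := fun i j hne h h' =>
      h (f.map_adj_iff.1 ((hM _ _).2 ⟨fun e => hne (f.injective e), h'⟩))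
    refine wheel_false M hP hH (a := f (.inl 0)) (b := f (.inl 1)) (c := f (.inl 2))
      (d := f (.inl 3)) (h := f (.inr ())) (pos _ _ ?_) (pos _ _ ?_) (pos _ _ ?_) (pos _ _ ?_)
      (neg _ _ ?_ ?_) (neg _ _ ?_ ?_) (pos _ _ ?_) (pos _ _ ?_) (pos _ _ ?_) (pos _ _ ?_) <;>
      simp [wheel]
  · refine ⟨fun f => ?_⟩
    have pos : ∀ i j, sun3.Adj i j → M.Inter (f i) (f j) := fun i j h =>
      ((hM _ _).1 (f.map_adj_iff.2 h)).2
    have neg : ∀ i j, i ≠ j → ¬ sun3.Adj i j → ¬ M.Inter (f i) (f j) := fun i j hne h h' =>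
      h (f.map_adj_iff.1 ((hM _ _).2 ⟨fun e => hne (f.injective e), h'⟩))
    refine sun_false M hP hH (a := f 0) (b := f 1) (c := f 2)
      (x := f 3) (y := f 4) (z := f 5) (pos _ _ ?_) (pos _ _ ?_) (pos _ _ ?_)
      (pos _ _ ?_) (pos _ _ ?_) (neg _ _ ?_ ?_)
      (pos _ _ ?_) (pos _ _ ?_) (neg _ _ ?_ ?_)
      (pos _ _ ?_) (pos _ _ ?_) (neg _ _ ?_ ?_) <;>
      simp [sun3]

end Forward

section Interval
variable {V : Type} [Fintype V]

lemma interval_model {G : SimpleGraph V} (c : V → ℕ) (T : ℕ) (hT : 0 < T)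
    (hc : Function.Injective c) (hcT : ∀ u v, c u ≠ c v + T)
    (hG : ∀ u v, u ≠ v → (G.Adj u v ↔ c u < c v + T ∧ c v < c u + T)) : IsPHCAGraph G := by
  classical
  obtain ⟨K, hK⟩ : ∃ K : ℕ, ∀ v, c v + T < K := by
    refine ⟨∑ v, c v + T + 1, fun v => ?_⟩
    have := Finset.single_le_sum (f := c) (fun i _ => Nat.zero_le _) (Finset.mem_univ v)
    omega
  -- coordinates
  have co1 : ∀ m : ℕ, m < K → co (((m / K : ℝ)) : Circ) = m / K := by
    intro m hm
    have hK0 : (0:ℝ) < K := by exact_mod_cast (by omega : 0 < K)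
    have hmK : (m : ℝ) < K := by exact_mod_cast hm
    exact coe_co _ (by positivity) ((div_lt_one hK0).2 hmK)
  have inj : ∀ m k : ℕ, m < K → k < K →
      ((((m / K : ℝ)) : Circ) = (((k / K : ℝ)) : Circ)) → m = k := by
    intro m k hm hk h
    have hK0 : (K:ℝ) ≠ 0 := by exact_mod_cast (by omega : K ≠ 0)
    have := congrArg co h
    rw [co1 m hm, co1 k hk, div_left_inj' hK0] at this
    exact_mod_cast this
  let M : CAModel V :=
    { arc := fun v => ⟨(((c v : ℕ) / K : ℝ) : Circ), (((c v + T : ℕ) / K : ℝ) : Circ)⟩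
      endpoints_distinct := by
        rintro ⟨u, _ | _⟩ ⟨v, _ | _⟩ h
        · have := inj _ _ (hK u) (hK v) (by simpa using h)
          have : u = v := hc (by omega)
          rw [this]
        · have := inj (c u + T) (c v) (hK u) (by have := hK v; omega) (by simpa using h)
          exact absurd this.symm (hcT _ _)
        · have := inj (c u) (c v + T) (by have := hK u; omega) (hK v) (by simpa using h)
          exact absurd this (hcT _ _)
        · have := inj (c u) (c v) (by have := hK u; omega) (by have := hK v; omega)
            (by simpa using h)
          rw [hc this] }
  have mem : ∀ (v : V) (x : Circ), x ∈ (M.arc v).pts ↔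
      (c v : ℝ) < co x * K ∧ co x * K < c v + T := by
    intro v x
    have hv := hK v
    have hK0 : (0:ℝ) < K := by exact_mod_cast (by omega : 0 < K)
    have hT' : (0:ℝ) < T := by exact_mod_cast hT
    show sbtw (((c v : ℕ) / K : ℝ) : Circ) x (((c v + T : ℕ) / K : ℝ) : Circ) ↔ _
    rw [sbtw_co, co1 _ (by omega), co1 _ hv]
    have hlt : (c v : ℝ) / K < ((c v + T : ℕ) : ℝ) / K := by
      rw [div_lt_div_iff_of_pos_right hK0]; push_cast; linarith
    rw [show (c v : ℝ) < co x * K ↔ (c v : ℝ) / K < co x from (div_lt_iff₀ hK0).symm]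
    rw [show co x * K < c v + T ↔ co x < ((c v + T : ℕ) : ℝ) / K by
      rw [lt_div_iff₀ hK0]; push_cast; rfl]
    unfold sb
    constructor
    · rintro (h | h | h)
      · exact h
      · exact absurd h.2 (by linarith)
      · exact absurd h.1 (by linarith)
    · exact fun h => Or.inl h
  have memR : ∀ u v, Rl M u v ↔ c v < c u ∧ c u < c v + T := by
    intro u v
    unfold Rl
    rw [mem]
    have hu := hK u
    have hK0 : (K:ℝ) ≠ 0 := by exact_mod_cast (by omega : K ≠ 0)
    have : co (M.arc u).s * K = c u := by
      show co (((c u : ℕ) / K : ℝ) : Circ) * K = c u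
      rw [co1 _ (by omega), div_mul_cancel₀ _ hK0]
    rw [this]
    norm_cast
  have ex : ∀ r : ℝ, 0 ≤ r → r < K → ∃ x : Circ, co x * K = r := by
    intro r h0 h1
    have hK0 : (0:ℝ) < K := by linarith
    refine ⟨((r / K : ℝ) : Circ), ?_⟩
    rw [coe_co _ (by positivity) ((div_lt_one hK0).2 h1), div_mul_cancel₀ _ hK0.ne']
  refine ⟨M, ?_, ?_, ?_⟩
  · intro u v huv hsub
    have hne : c u ≠ c v := fun h => huv (hc h)
    have hT' : (1:ℝ) ≤ T := by exact_mod_cast hT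
    have hKu : (c u : ℝ) + T < K := by exact_mod_cast hK u
    rcases lt_or_gt_of_ne hne with h | h
    · have h' : (c u : ℝ) + 1 ≤ c v := by exact_mod_cast h
      obtain ⟨x, hx⟩ := ex (c u + 1 / 2) (by positivity) (by linarith)
      have := (mem v x).1 (hsub.1 ((mem u x).2 (by rw [hx]; constructor <;> linarith)))
      rw [hx] at this
      linarith [this.1]
    · have h' : (c v : ℝ) + 1 ≤ c u := by exact_mod_cast h
      have h0 : (0:ℝ) ≤ c u := Nat.cast_nonneg _
      obtain ⟨x, hx⟩ := ex (c u + T - 1 / 2) (by linarith) (by linarith)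
      have := (mem v x).1 (hsub.1 ((mem u x).2 (by rw [hx]; constructor <;> linarith)))
      rw [hx] at this
      linarith [this.2]
  · refine helly_of M ?_ ?_
    · intro u v h1 h2
      rw [memR] at h1 h2; omega
    · intro u v w h1 h2 h3
      rw [memR] at h1 h2 h3; omega
  · intro u v
    constructor
    · intro h
      have hne := h.ne
      refine ⟨hne, ?_⟩
      have hh := (hG u v hne).1 h
      have hcne : c u ≠ c v := fun h => hne (hc h)
      rcases lt_or_gt_of_ne hcne with h | h
      · exact inter_symm M (inter_of_Rl M ((memR v u).2 ⟨h, hh.2⟩))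
      · exact inter_of_Rl M ((memR u v).2 ⟨h, hh.1⟩)
    · rintro ⟨hne, h⟩
      rw [hG u v hne]
      rcases Rl_of_inter M hne h with h | h
      · rw [memR] at h; omega
      · rw [memR] at h; omega

lemma lex_lt {n a b e e' : ℕ} (he' : e' < n) (h : a < b) (he : e < n) :
    n * a + e < n * b + e' := by
  have : n * (a + 1) ≤ n * b := Nat.mul_le_mul_left _ h
  rw [Nat.mul_add] at this
  omega

lemma lex_inj {n a b e e' : ℕ} (he : e < n) (he' : e' < n)
    (h : n * a + e = n * b + e') : e = e' := by
  have := congrArg (· % n) h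
  simpa [Nat.add_mod, Nat.mod_eq_of_lt he, Nat.mod_eq_of_lt he'] using this

/-- co-bipartite graphs with nested neighbourhoods are proper Helly circular-arc graphs -/
lemma cobip {G : SimpleGraph V} (L : V → Prop)
    (hL : ∀ u v, u ≠ v → L u → L v → G.Adj u v)
    (hR : ∀ u v, u ≠ v → ¬ L u → ¬ L v → G.Adj u v)
    (hN : ∀ l l' r r', L l → L l' → ¬ L r → ¬ L r' → G.Adj l r → ¬ G.Adj l' r → G.Adj l' r' →
      ¬ G.Adj l r' → False) : IsPHCAGraph G := by
  classical
  let n := Fintype.card V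
  let e : V → ℕ := fun v => (Fintype.equivFin V v : ℕ)
  have he : ∀ v, e v < n := fun v => (Fintype.equivFin V v).2
  have einj : Function.Injective e := fun u v h =>
    (Fintype.equivFin V).injective (Fin.ext h)
  let F : V → ℕ := fun l => (Finset.univ.filter fun l' =>
    L l' ∧ ∀ r, ¬ L r → G.Adj l' r → G.Adj l r).card
  let g : V → ℕ := fun r => (Finset.univ.filter fun l => L l ∧ ¬ G.Adj l r).card
  have hF : ∀ v, F v ≤ n := fun v => Finset.card_le_univ _
  have hg : ∀ v, g v ≤ n := fun v => Finset.card_le_univ _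
  have key : ∀ l r, L l → ¬ L r → (G.Adj l r ↔ g r < F l) := by
    intro l r hl hr
    constructor
    · intro h
      refine Finset.card_lt_card ⟨?_, ?_⟩
      · intro l' hl'
        simp only [Finset.mem_filter, Finset.mem_univ, true_and] at hl' ⊢
        refine ⟨hl'.1, fun r' hr' h' => ?_⟩
        by_contra hc
        exact hN l l' r r' hl hl'.1 hr hr' h hl'.2 h' hc
      · intro hsub
        have := hsub (x := l) (by simp [hl])
        simp only [Finset.mem_filter, Finset.mem_univ, true_and] at this
        exact this.2 h
    · intro h
      by_contra hc
      refine absurd h (not_lt.2 (Finset.card_le_card ?_))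
      intro l' hl'
      simp only [Finset.mem_filter, Finset.mem_univ, true_and] at hl' ⊢
      exact ⟨hl'.1, fun h' => hc (hl'.2 r hr h')⟩
  let st : V → ℕ := fun v => if L v then 2 * F v else (2 * n + 4) + (2 * g v + 1)
  let T := n * (2 * n + 4)
  have hTst : ∀ v, n * st v + e v + T = n * (st v + (2 * n + 4)) + e v := by
    intro v; simp only [T]; ring
  have lt_iff : ∀ u v, e u ≠ e v ∨ True → st u ≠ st v + (2 * n + 4) →
      (n * st u + e u < n * st v + e v + T ↔ st u < st v + (2 * n + 4)) := by
    intro u v _ hne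
    rw [hTst]
    constructor
    · intro h
      by_contra hc
      have := lex_lt (he u) (show st v + (2 * n + 4) < st u by omega) (he v)
      omega
    · intro h
      exact lex_lt (he v) h (he u)
  by_cases hV : IsEmpty V
  · exact interval_model (fun _ => 0) 1 one_pos (fun u => (hV.false u).elim)
      (fun u => (hV.false u).elim) (fun u => (hV.false u).elim)
  have hn : 0 < n := by
    rw [not_isEmpty_iff] at hV
    exact Fintype.card_pos
  refine interval_model (fun v => n * st v + e v) T (by positivity) ?_ ?_ ?_
  · intro u v h
    exact einj (lex_inj (he u) (he v) h)
  · intro u v h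
    have h' := h

    rw [hTst] at h
    have := einj (lex_inj (he u) (he v) h)
    subst this
    have : 0 < T := by positivity
    omega
  · intro u v huv
    have Fu := hF u; have Fv := hF v; have gu := hg u; have gv := hg v
    have su : st u = if L u then 2 * F u else (2 * n + 4) + (2 * g u + 1) := rfl
    have sv : st v = if L v then 2 * F v else (2 * n + 4) + (2 * g v + 1) := rfl
    have hne1 : st u ≠ st v + (2 * n + 4) := by
      rw [su, sv]; split_ifs <;> omega
    have hne2 : st v ≠ st u + (2 * n + 4) := by
      rw [su, sv]; split_ifs <;> omega
    rw [lt_iff u v (Or.inr trivial) hne1, lt_iff v u (Or.inr trivial) hne2]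
    by_cases hu : L u <;> by_cases hv : L v
    · simp only [hu, hv, if_true] at su sv
      exact ⟨fun _ => by omega, fun _ => hL u v huv hu hv⟩
    · simp only [hu, hv, if_true, if_false] at su sv
      rw [key u v hu hv]; omega
    · simp only [hu, hv, if_true, if_false] at su sv
      rw [G.adj_comm, key v u hv hu]; omega
    · simp only [hu, hv, if_false] at su sv
      exact ⟨fun _ => by omega, fun _ => hR u v huv hu hv⟩

lemma case_univ {G : SimpleGraph V} (M : CAModel V) (hP : M.Proper) (hM : M.IsModelOf G)
    (hW : IsEmpty (wheel 4 ↪g G)) (u : V) (hU : ∀ w, M.Inter w u) : IsPHCAGraph G := by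
  have adj : ∀ {u v}, u ≠ v → M.Inter u v → G.Adj u v := fun h h' => (hM _ _).2 ⟨h, h'⟩
  have uadj : ∀ {w}, w ≠ u → G.Adj u w := fun h => (adj h (hU _)).symm
  have clL : ∀ v w, v ≠ w → (v = u ∨ Rl M u v) → (w = u ∨ Rl M u w) → G.Adj v w := by
    rintro v w hne (rfl | hv) (rfl | hw)
    · exact absurd rfl hne
    · exact uadj hne.symm
    · exact (uadj hne).symm
    · exact adj hne ⟨_, hv, hw⟩
  have hR : ∀ v, ¬ (v = u ∨ Rl M u v) → (M.arc u).t ∈ (M.arc v).pts := by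
    intro v hv
    push Not at hv
    have hvu : Rl M v u := (Rl_of_inter M hv.1 (hU v)).resolve_right hv.2
    by_contra ht
    refine hP v u hv.1 ⟨fun x hx => ?_, fun hsub => Rl_irrefl M v (hsub hvu)⟩
    exact ord_sub hvu hv.2 ht (s_ne_t M v v) (s_ne_t M u v)
      (fun e => hv.1 (t_inj M e).symm) x hx
  have clR : ∀ v w, v ≠ w → ¬ (v = u ∨ Rl M u v) → ¬ (w = u ∨ Rl M u w) → G.Adj v w :=
    fun v w hne hv hw => adj hne ⟨_, hR v hv, hR w hw⟩
  refine cobip (fun v => v = u ∨ Rl M u v) clL clR ?_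
  intro l l' r r' hl hl' hr hr' h1 h2 h3 h4
  have nl : l ≠ l' := by rintro rfl; exact h2 h1
  have nr : r ≠ r' := by rintro rfl; exact h2 h3
  have ru : r ≠ u := fun h => hr (Or.inl h)
  have ru' : r' ≠ u := fun h => hr' (Or.inl h)
  have lu : l ≠ u := by rintro rfl; exact h4 (uadj ru')
  have lu' : l' ≠ u := by rintro rfl; exact h2 (uadj ru)
  refine no_wheel hW (a := l) (b := r) (c := r') (d := l') (h := u) h1 (clR _ _ nr hr hr')
    h3.symm (clL _ _ nl.symm hl' hl) h4 (fun h => h2 h.symm) ?_ ?_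
    (uadj lu) (uadj ru) (uadj ru') (uadj lu')
  · rintro rfl; exact hr' hl
  · rintro rfl; exact hr hl'

end Interval

/-- A PCA graph is a PHCA graph iff it contains no induced `W_4` and no
induced 3-sun. -/
theorem stmt_9 {V : Type} [Fintype V] (G : SimpleGraph V) (hG : IsPCAGraph G) :
    IsPHCAGraph G ↔ (IsEmpty (wheel 4 ↪g G) ∧ IsEmpty (sun3 ↪g G)) := by
  refine ⟨forward, fun ⟨hW, hS⟩ => ?_⟩
  obtain ⟨M, hP, hM⟩ := hG
  by_cases hU : ∀ u, ∃ w, ¬ M.Inter w u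
  · exact case_no_univ M hP hM hW hS hU
  · push Not at hU
    obtain ⟨u, hu⟩ := hU
    exact case_univ M hP hM hW u hu
end
end

section
/- Every proper circular-arc (PCA) model of a proper Helly circular-arc (PHCA) graph that is not an interval graph is itself a PHCA model; that is, if G is a PHCA graph admitting no interval model, then every proper circular-arc model whose intersection graph is isomorphic to G is also Helly. -/
open Set

noncomputable section

/-! ### Coordinates on the circle -/

/-- Coordinate of `x` measured from the base point `p`. -/
def rr (p x : Circ) : ℝ := ((AddCircle.equivIco (1:ℝ) 0) (x - p) : ℝ)

/-- Strict cyclic order of three reals. -/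
def Cyc (a b c : ℝ) : Prop := (a < b ∧ b < c) ∨ (b < c ∧ c < a) ∨ (c < a ∧ a < b)

lemma rr_nonneg (p x : Circ) : 0 ≤ rr p x := ((AddCircle.equivIco (1:ℝ) 0) (x - p)).2.1

lemma rr_lt_one (p x : Circ) : rr p x < 1 := by
  have := ((AddCircle.equivIco (1:ℝ) 0) (x - p)).2.2
  simpa [rr] using this

lemma rr_coe (p x : Circ) : ((rr p x : ℝ) : Circ) = x - p := AddCircle.coe_equivIco

lemma rr_inj (p : Circ) {x y : Circ} (h : rr p x = rr p y) : x = y := by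
  have h1 := rr_coe p x
  have h2 := rr_coe p y
  rw [h] at h1
  rw [h1] at h2
  simpa using h2

lemma rr_self (p : Circ) : rr p p = 0 := by
  have : ((AddCircle.equivIco (1:ℝ) 0) ((0:ℝ) : Circ)) = ⟨0, by simp⟩ :=
    AddCircle.equivIco_coe_eq (p := (1:ℝ)) (a := 0) _
  unfold rr
  rw [sub_self]
  have h0 : (0 : Circ) = ((0:ℝ) : Circ) := rfl
  rw [h0, this]

lemma rr_of_real (p : Circ) {y : ℝ} (h0 : 0 ≤ y) (h1 : y < 1) : rr p (p + (y : Circ)) = y := by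
  have : ((AddCircle.equivIco (1:ℝ) 0) ((y:ℝ) : Circ)) = ⟨y, by simp [h0, h1]⟩ :=
    AddCircle.equivIco_coe_eq (p := (1:ℝ)) (a := 0) _
  unfold rr
  rw [add_sub_cancel_left, this]

lemma rr_surj (p : Circ) {y : ℝ} (h0 : 0 ≤ y) (h1 : y < 1) : ∃ x, rr p x = y :=
  ⟨_, rr_of_real p h0 h1⟩

lemma btw_sub (p a b c : Circ) : btw a b c ↔ btw (a - p) (b - p) (c - p) := by
  induction p using QuotientAddGroup.induction_on with | H p =>
  induction a using QuotientAddGroup.induction_on with | H a =>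
  induction b using QuotientAddGroup.induction_on with | H b =>
  induction c using QuotientAddGroup.induction_on with | H c =>
  rw [← QuotientAddGroup.mk_sub, ← QuotientAddGroup.mk_sub, ← QuotientAddGroup.mk_sub,
    QuotientAddGroup.btw_coe_iff', QuotientAddGroup.btw_coe_iff']
  simp

lemma btw_coe_real {a b c : ℝ} (ha0 : 0 ≤ a) (ha : a < 1) (hb0 : 0 ≤ b) (hb : b < 1)
    (hc0 : 0 ≤ c) (hc : c < 1) :
    btw (a : Circ) (b : Circ) (c : Circ) ↔ ¬ Cyc c b a := by
  have h := QuotientAddGroup.btw_coe_iff (p := (1:ℝ)) (x₁ := a) (x₂ := b) (x₃ := c)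
  refine h.trans ?_
  have hI : toIcoMod one_pos a b = if a ≤ b then b else b + 1 := by
    rw [toIcoMod_eq_iff]
    split_ifs with h
    · exact ⟨⟨h, by linarith⟩, 0, by simp⟩
    · exact ⟨⟨by linarith, by linarith⟩, -1, by simp⟩
  have hJ : toIocMod one_pos a c = if a < c then c else c + 1 := by
    rw [toIocMod_eq_iff]
    split_ifs with h
    · exact ⟨⟨h, by linarith⟩, 0, by simp⟩
    · exact ⟨⟨by linarith, by linarith⟩, -1, by simp⟩
  rw [hI, hJ]
  unfold Cyc
  split_ifs <;> grind

lemma sbtw_iff_rr (p a b c : Circ) : sbtw a b c ↔ Cyc (rr p a) (rr p b) (rr p c) := by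
  rw [sbtw_iff_not_btw, btw_sub p, ← rr_coe, ← rr_coe, ← rr_coe,
    btw_coe_real (rr_nonneg _ _) (rr_lt_one _ _) (rr_nonneg _ _) (rr_lt_one _ _)
      (rr_nonneg _ _) (rr_lt_one _ _), not_not]

lemma mem_iff (p : Circ) (A : Arc) (x : Circ) :
    x ∈ A.pts ↔ Cyc (rr p A.s) (rr p x) (rr p A.t) := sbtw_iff_rr p _ _ _

/-! ### Basic facts about models -/

namespace CAModel

variable {V : Type} [Fintype V] (M : CAModel V)

lemma s_ne_t (u v : V) : (M.arc u).s ≠ (M.arc v).t := by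
  intro h
  have := M.endpoints_distinct (a₁ := (u, true)) (a₂ := (v, false)) (by simpa using h)
  simp at this

lemma s_ne_s {u v : V} (huv : u ≠ v) : (M.arc u).s ≠ (M.arc v).s := by
  intro h
  have := M.endpoints_distinct (a₁ := (u, true)) (a₂ := (v, true)) (by simpa using h)
  simp at this
  exact huv this

lemma t_ne_t {u v : V} (huv : u ≠ v) : (M.arc u).t ≠ (M.arc v).t := by
  intro h
  have := M.endpoints_distinct (a₁ := (u, false)) (a₂ := (v, false)) (by simpa using h)
  simp at this
  exact huv this

lemma inter_symm {u v : V} (h : M.Inter u v) : M.Inter v u := by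
  obtain ⟨x, h1, h2⟩ := h
  exact ⟨x, h2, h1⟩

lemma inter_comm {u v : V} : M.Inter u v ↔ M.Inter v u := ⟨M.inter_symm, M.inter_symm⟩

lemma inter_of_mem {u v : V} {x : Circ} (h1 : x ∈ (M.arc u).pts) (h2 : x ∈ (M.arc v).pts) :
    M.Inter u v := ⟨x, h1, h2⟩

lemma rr_st (p : Circ) (u v : V) : rr p (M.arc u).s ≠ rr p (M.arc v).t :=
  fun h => M.s_ne_t u v (rr_inj p h)

lemma rr_ss (p : Circ) {u v : V} (h : u ≠ v) : rr p (M.arc u).s ≠ rr p (M.arc v).s :=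
  fun h' => M.s_ne_s h (rr_inj p h')

lemma rr_tt (p : Circ) {u v : V} (h : u ≠ v) : rr p (M.arc u).t ≠ rr p (M.arc v).t :=
  fun h' => M.t_ne_t h (rr_inj p h')

lemma inter_self (u : V) : M.Inter u u := by
  set p := (M.arc u).s with hp
  have h0 : rr p (M.arc u).s = 0 := rr_self _
  have h1 := rr_nonneg p (M.arc u).t
  have h2 := rr_lt_one p (M.arc u).t
  have h3 := M.rr_st p u u
  rw [h0] at h3
  have h4 : 0 < rr p (M.arc u).t := lt_of_le_of_ne h1 h3
  obtain ⟨x, hx⟩ := rr_surj p (y := rr p (M.arc u).t / 2) (by linarith) (by linarith)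
  have : x ∈ (M.arc u).pts := by
    rw [mem_iff p, h0, hx]
    left
    constructor <;> linarith
  exact ⟨x, this, this⟩

lemma inter_of_s_mem {u v : V} (h : (M.arc u).s ∈ (M.arc v).pts) : M.Inter u v := by
  set p := (M.arc u).s with hp
  have h0 : rr p p = 0 := rr_self _
  have h1 := rr_nonneg p (M.arc u).t
  have h2 := rr_lt_one p (M.arc u).t
  have h3 := M.rr_st p u u
  rw [← hp, h0] at h3
  have h4 : 0 < rr p (M.arc u).t := lt_of_le_of_ne h1 h3
  have h5 := rr_nonneg p (M.arc v).t
  have h6 := rr_nonneg p (M.arc v).s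
  rw [mem_iff p, h0] at h
  have h7 : 0 < rr p (M.arc v).t ∧ rr p (M.arc v).t < rr p (M.arc v).s := by
    unfold Cyc at h
    grind
  obtain ⟨x, hx⟩ := rr_surj p (y := min (rr p (M.arc u).t) (rr p (M.arc v).t) / 2)
    (by have := le_min h1 h5; linarith) (by have := min_le_left (rr p (M.arc u).t) (rr p (M.arc v).t); linarith)
  have e1 := min_le_left (rr p (M.arc u).t) (rr p (M.arc v).t)
  have e2 := min_le_right (rr p (M.arc u).t) (rr p (M.arc v).t)
  have e3 := lt_min h4 h7.1
  refine ⟨x, ?_, ?_⟩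
  · rw [mem_iff p, ← hp, h0, hx]
    left
    constructor <;> linarith
  · rw [mem_iff p, hx]
    right; left
    constructor <;> linarith

lemma inter_iff {u v : V} (huv : u ≠ v) :
    M.Inter u v ↔ (M.arc u).s ∈ (M.arc v).pts ∨ (M.arc v).s ∈ (M.arc u).pts := by
  constructor
  · rintro ⟨x, h1, h2⟩
    set p : Circ := 0
    rw [mem_iff p] at *
    rw [mem_iff p]
    have := M.rr_ss p huv
    unfold Cyc at *
    grind
  · rintro (h | h)
    · exact M.inter_of_s_mem h
    · exact M.inter_symm (M.inter_of_s_mem h)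

/-- In a proper model, no arc sits inside another one. -/
lemma Proper.not_inside {M : CAModel V} (hP : M.Proper) {u v : V} (huv : u ≠ v)
    (h1 : (M.arc u).s ∈ (M.arc v).pts) (h2 : (M.arc u).t ∈ (M.arc v).pts)
    (h3 : (M.arc v).s ∉ (M.arc u).pts) : False := by
  refine hP u v huv ⟨?_, fun h => ?_⟩
  · intro x hx
    set p : Circ := 0
    rw [mem_iff p] at *
    have := M.rr_ss p huv
    unfold Cyc at *
    grind
  · have h4 := h h1
    rw [mem_iff 0] at h4
    unfold Cyc at h4
    grind

/-- In a proper model, if `w` misses something that `c` meets, then `w` is not inside `c`. -/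
lemma Proper.exists_diff {M : CAModel V} (hP : M.Proper) {w c d : V}
    (hwd : ¬ M.Inter w d) (hcd : M.Inter c d) :
    ∃ y, y ∉ (M.arc c).pts ∧ y ∉ (M.arc d).pts := by
  have hwc : w ≠ c := by rintro rfl; exact hwd hcd
  by_contra hcon
  push Not at hcon
  have hsub : (M.arc w).pts ⊆ (M.arc c).pts := by
    intro x hx
    by_contra hxc
    exact hwd ⟨x, hx, hcon x hxc⟩
  refine hP w c hwc ⟨hsub, fun h => ?_⟩
  obtain ⟨x, hx1, hx2⟩ := hcd
  exact hwd ⟨x, h hx1, hx2⟩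

lemma Helly.triple {M : CAModel V} (hH : M.Helly) {a b c : V} (hab : M.Inter a b)
    (hbc : M.Inter b c) (hac : M.Inter a c) :
    ∃ p, p ∈ (M.arc a).pts ∧ p ∈ (M.arc b).pts ∧ p ∈ (M.arc c).pts := by
  obtain ⟨p, hp⟩ := hH {a, b, c} (by
    rintro u (rfl | rfl | rfl) v (rfl | rfl | rfl) <;>
    first | exact M.inter_self _ | assumption | (apply M.inter_symm; assumption))
  exact ⟨p, hp a (by simp), hp b (by simp), hp c (by simp)⟩

/-- Convexity of the intersection of two arcs that do not cover the circle. -/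
lemma convex_aux {c d : V} {y p x q : Circ} (hyc : y ∉ (M.arc c).pts) (hyd : y ∉ (M.arc d).pts)
    (hpc : p ∈ (M.arc c).pts) (hpd : p ∈ (M.arc d).pts)
    (hqc : q ∈ (M.arc c).pts) (hqd : q ∈ (M.arc d).pts)
    (h1 : rr (M.arc c).s p < rr (M.arc c).s x) (h2 : rr (M.arc c).s x < rr (M.arc c).s q) :
    x ∈ (M.arc d).pts := by
  obtain ⟨b, hb⟩ : ∃ b, b = (M.arc c).s := ⟨_, rfl⟩
  have h0 : rr b (M.arc c).s = 0 := by rw [hb]; exact rr_self _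
  rw [← hb] at h1 h2
  clear hb
  have n1 := rr_nonneg b y
  have n2 := rr_nonneg b (M.arc c).t
  rw [mem_iff b] at *
  unfold Cyc at *
  grind

/-- A proper Helly model has no induced 4-wheel. -/
lemma no_wheel (hP : M.Proper) (hH : M.Helly) {c x1 x2 x3 x4 : V}
    (c1 : M.Inter c x1) (c2 : M.Inter c x2) (c3 : M.Inter c x3) (c4 : M.Inter c x4)
    (h12 : M.Inter x1 x2) (h23 : M.Inter x2 x3) (h34 : M.Inter x3 x4) (h41 : M.Inter x4 x1)
    (h13 : ¬ M.Inter x1 x3) (h24 : ¬ M.Inter x2 x4) : False := by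
  obtain ⟨a, a0, a1, a2⟩ := hH.triple c1 h12 c2
  obtain ⟨b, b0, b2, b3⟩ := hH.triple c2 h23 c3
  obtain ⟨e, e0, e3, e4⟩ := hH.triple c3 h34 c4
  obtain ⟨d, d0, d4, d1⟩ := hH.triple c4 h41 c1
  obtain ⟨y1, y1c, y1d⟩ := hP.exists_diff (fun h => h13 (M.inter_symm h)) c1
  obtain ⟨y2, y2c, y2d⟩ := hP.exists_diff (fun h => h24 (M.inter_symm h)) c2
  obtain ⟨y3, y3c, y3d⟩ := hP.exists_diff h13 c3
  obtain ⟨y4, y4c, y4d⟩ := hP.exists_diff h24 c4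
  have n1b : b ∉ (M.arc x1).pts := fun h => h13 ⟨b, h, b3⟩
  have n1e : e ∉ (M.arc x1).pts := fun h => h13 ⟨e, h, e3⟩
  have n2e : e ∉ (M.arc x2).pts := fun h => h24 ⟨e, h, e4⟩
  have n2d : d ∉ (M.arc x2).pts := fun h => h24 ⟨d, h, d4⟩
  have n3d : d ∉ (M.arc x3).pts := fun h => h13 ⟨d, d1, h⟩
  have n3a : a ∉ (M.arc x3).pts := fun h => h13 ⟨a, a1, h⟩
  have n4a : a ∉ (M.arc x4).pts := fun h => h24 ⟨a, a2, h⟩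
  have n4b : b ∉ (M.arc x4).pts := fun h => h24 ⟨b, b2, h⟩
  set q := (M.arc c).s with hq
  have ne : ∀ {x y : Circ} {v : V}, x ∈ (M.arc v).pts → y ∉ (M.arc v).pts → rr q x ≠ rr q y := by
    intro x y v hx hy h
    exact hy (rr_inj q h ▸ hx)
  have E1 := fun x => M.convex_aux (x := x) y1c y1d a0 a1 d0 d1
  have E1' := fun x => M.convex_aux (x := x) y1c y1d d0 d1 a0 a1
  have E2 := fun x => M.convex_aux (x := x) y2c y2d a0 a2 b0 b2
  have E2' := fun x => M.convex_aux (x := x) y2c y2d b0 b2 a0 a2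
  have E3 := fun x => M.convex_aux (x := x) y3c y3d b0 b3 e0 e3
  have E3' := fun x => M.convex_aux (x := x) y3c y3d e0 e3 b0 b3
  have E4 := fun x => M.convex_aux (x := x) y4c y4d e0 e4 d0 d4
  have E4' := fun x => M.convex_aux (x := x) y4c y4d d0 d4 e0 e4
  have m1 := ne a1 n1b
  have m2 := ne a1 n1e
  have m3 := ne a2 n2d
  have m4 := ne b2 n2e
  have m5 := ne b2 n2d
  have m6 := ne e3 n3d
  have f1 := fun h k => n1b (E1 b h k)
  have f2 := fun h k => n1b (E1' b h k)
  have f3 := fun h k => n1e (E1 e h k)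
  have f4 := fun h k => n1e (E1' e h k)
  have f5 := fun h k => n2e (E2 e h k)
  have f6 := fun h k => n2e (E2' e h k)
  have f7 := fun h k => n2d (E2 d h k)
  have f8 := fun h k => n2d (E2' d h k)
  have f9 := fun h k => n3d (E3 d h k)
  have g1 := fun h k => n3d (E3' d h k)
  have g2 := fun h k => n3a (E3 a h k)
  have g3 := fun h k => n3a (E3' a h k)
  have g4 := fun h k => n4a (E4 a h k)
  have g5 := fun h k => n4a (E4' a h k)
  have g6 := fun h k => n4b (E4 b h k)
  have g7 := fun h k => n4b (E4' b h k)
  clear E1 E1' E2 E2' E3 E3' E4 E4'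
  rw [← hq] at *
  generalize rr q a = A at *
  generalize rr q b = B at *
  generalize rr q d = D at *
  generalize rr q e = E at *
  clear ne n1b n1e n2e n2d n3d n3a n4a n4b y1c y2c y3c y4c y1d y2d y3d y4d
  clear a0 a1 a2 b0 b2 b3 e0 e3 e4 d0 d1 d4 c1 c2 c3 c4 h12 h23 h34 h41 h13 h24 hP hH
  grind

/-- A proper Helly model has no induced 3-sun. -/
lemma no_sun (hP : M.Proper) (hH : M.Helly) {v1 v2 v3 w1 w2 w3 : V}
    (h12 : M.Inter v1 v2) (h23 : M.Inter v2 v3) (h13 : M.Inter v1 v3)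
    (a1 : M.Inter w1 v1) (a2 : M.Inter w1 v2) (a3 : ¬ M.Inter w1 v3)
    (b2 : M.Inter w2 v2) (b3 : M.Inter w2 v3) (b1 : ¬ M.Inter w2 v1)
    (c3 : M.Inter w3 v3) (c1 : M.Inter w3 v1) (c2 : ¬ M.Inter w3 v2) : False := by
  obtain ⟨p, p1, p2, p3⟩ := hH.triple h12 h23 h13
  obtain ⟨x, x1, x2, x3⟩ := hH.triple a1 h12 a2
  obtain ⟨y, y1, y2, y3⟩ := hH.triple b2 h23 b3
  obtain ⟨z, z1, z2, z3⟩ := hH.triple c1 h13 c3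
  have x4 : x ∉ (M.arc v3).pts := fun h => a3 ⟨x, x1, h⟩
  have y4 : y ∉ (M.arc v1).pts := fun h => b1 ⟨y, y1, h⟩
  have z4 : z ∉ (M.arc v2).pts := fun h => c2 ⟨z, z1, h⟩
  obtain ⟨e, e1, e2⟩ := hP.exists_diff b1 (M.inter_symm h12)
  obtain ⟨f, f1, f2⟩ := hP.exists_diff c2 (M.inter_symm h23)
  obtain ⟨g, g1, g2⟩ := hP.exists_diff a3 h13
  have key : ∀ v, p ∈ (M.arc v).pts → rr p (M.arc v).t < rr p (M.arc v).s ∧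
      ∀ x, x ∈ (M.arc v).pts ↔ rr p x < rr p (M.arc v).t ∨ rr p (M.arc v).s < rr p x := by
    intro v hv
    have h0 : rr p p = 0 := rr_self p
    have n1 := rr_nonneg p (M.arc v).t
    have n2 := rr_nonneg p (M.arc v).s
    rw [mem_iff p, h0] at hv
    have h : rr p (M.arc v).t < rr p (M.arc v).s := by unfold Cyc at hv; grind
    refine ⟨h, fun x => ?_⟩
    rw [mem_iff p]
    unfold Cyc
    grind
  obtain ⟨k1, K1⟩ := key v1 p1
  obtain ⟨k2, K2⟩ := key v2 p2
  obtain ⟨k3, K3⟩ := key v3 p3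
  rw [K1] at *
  rw [K2] at *
  rw [K3] at *
  grind

end CAModel

namespace CAModel

variable {V : Type} [Fintype V] (M : CAModel V)

lemma Proper.no_subset {M : CAModel V} (hP : M.Proper) {w c d : V}
    (hwd : ¬ M.Inter w d) (hcd : M.Inter c d) (hsub : (M.arc w).pts ⊆ (M.arc c).pts) : False := by
  have hwc : w ≠ c := by rintro rfl; exact hwd hcd
  refine hP w c hwc ⟨hsub, fun h => ?_⟩
  obtain ⟨x, hx1, hx2⟩ := hcd
  exact hwd ⟨x, h hx1, hx2⟩

/-- Two arcs of a proper model covering the circle are universal. -/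
lemma Proper.universal_of_ends {M : CAModel V} (hP : M.Proper) {u v : V} (huv : u ≠ v)
    (h1 : (M.arc u).s ∈ (M.arc v).pts) (h2 : (M.arc u).t ∈ (M.arc v).pts) (w : V) :
    M.Inter w u := by
  by_contra hw
  obtain ⟨y, hy1, hy2⟩ := hP.exists_diff hw (M.inter_symm (M.inter_of_s_mem h1))
  refine hP.not_inside huv h1 h2 fun h3 => ?_
  rw [mem_iff 0] at *
  unfold Cyc at *
  grind

/-- In a proper model an arc intersecting `b` contains one of its endpoints. -/
lemma Proper.end_mem {M : CAModel V} (hP : M.Proper) {b w : V} (hwb : w ≠ b)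
    (h : M.Inter w b) : (M.arc b).s ∈ (M.arc w).pts ∨ (M.arc b).t ∈ (M.arc w).pts := by
  by_contra hcon
  push Not at hcon
  obtain ⟨h1, h2⟩ := hcon
  have h3 : (M.arc w).s ∈ (M.arc b).pts := by
    rcases (M.inter_iff hwb).1 h with h | h
    · exact h
    · exact absurd h h1
  refine hP.not_inside hwb h3 ?_ h1
  have e1 := M.rr_tt 0 hwb
  have e2 := M.rr_ss 0 hwb
  have e3 := M.rr_st 0 b w
  have e4 := M.rr_st 0 w w
  have e5 := M.rr_st 0 w b
  rw [mem_iff 0] at *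
  unfold Cyc at *
  grind

/-- A proper model which is not Helly and has no universal arc contains three pairwise
intersecting arcs that cover the circle. -/
lemma exists_cover (hP : M.Proper) (hU : ∀ u, ∃ w, ¬ M.Inter w u) (S : Set V)
    (hS : ∀ u ∈ S, ∀ v ∈ S, M.Inter u v) (hno : ¬ ∃ p : Circ, ∀ v ∈ S, p ∈ (M.arc v).pts) :
    ∃ a b c, M.Inter a b ∧ M.Inter b c ∧ M.Inter a c ∧
      ∀ y, y ∈ (M.arc a).pts ∨ y ∈ (M.arc b).pts ∨ y ∈ (M.arc c).pts := by
  classical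
  have hNP : ∀ {u v : V}, u ≠ v → (M.arc u).s ∈ (M.arc v).pts → (M.arc u).t ∈ (M.arc v).pts →
      False := by
    intro u v huv h1 h2
    obtain ⟨w, hw⟩ := hU u
    exact hw (hP.universal_of_ends huv h1 h2 w)
  obtain ⟨a, ha⟩ : S.Nonempty := by
    by_contra h
    rw [Set.not_nonempty_iff_eq_empty] at h
    exact hno ⟨0, by simp [h]⟩
  obtain ⟨q, hq⟩ : ∃ q, q = (M.arc a).s := ⟨_, rfl⟩
  have q0 : rr q (M.arc a).s = 0 := by rw [hq]; exact rr_self _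
  have T0 : 0 < rr q (M.arc a).t :=
    lt_of_le_of_ne (rr_nonneg _ _) (by rw [← q0]; exact M.rr_st q a a)
  have T1 := rr_lt_one q (M.arc a).t
  -- the two kinds of arcs
  have hA : ∀ b, b ≠ a → (M.arc a).s ∈ (M.arc b).pts →
      rr q (M.arc b).t < rr q (M.arc a).t ∧ rr q (M.arc a).t < rr q (M.arc b).s ∧
      0 < rr q (M.arc b).t := by
    intro b hb h
    have h2 := fun h' => hNP (Ne.symm hb) h h'
    have e1 := M.rr_tt q hb
    have e2 := M.rr_st q b a
    have e3 := rr_nonneg q (M.arc b).t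
    have e4 := rr_nonneg q (M.arc b).s
    have e5 := M.rr_st q a b
    have e6 := M.rr_ss q hb
    rw [mem_iff q] at *
    unfold Cyc at *
    grind
  have hB : ∀ b, b ≠ a → (M.arc a).t ∈ (M.arc b).pts →
      0 < rr q (M.arc b).s ∧ rr q (M.arc b).s < rr q (M.arc a).t ∧
      rr q (M.arc a).t < rr q (M.arc b).t := by
    intro b hb h
    have h2 := fun h' => hNP (Ne.symm hb) h' h
    have e1 := M.rr_tt q hb
    have e2 := M.rr_st q b a
    have e3 := rr_nonneg q (M.arc b).t
    have e4 := rr_nonneg q (M.arc b).s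
    have e5 := M.rr_st q a b
    have e6 := M.rr_ss q hb
    rw [mem_iff q] at *
    unfold Cyc at *
    grind
  by_cases hex : ∃ b ∈ S, ∃ c ∈ S, b ≠ a ∧ c ≠ a ∧ (M.arc a).s ∈ (M.arc b).pts ∧
      (M.arc a).t ∈ (M.arc c).pts ∧ rr q (M.arc b).t ≤ rr q (M.arc c).s
  · obtain ⟨b, hb, c, hc, hba, hca, hab, hac, hle⟩ := hex
    refine ⟨a, b, c, hS _ ha _ hb, hS _ hb _ hc, hS _ ha _ hc, ?_⟩
    obtain ⟨A1, A2, A3⟩ := hA b hba hab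
    obtain ⟨B1, B2, B3⟩ := hB c hca hac
    have hbc : b ≠ c := by rintro rfl; linarith
    have h := (M.inter_iff hbc).1 (hS _ hb _ hc)
    have e5 := M.rr_st q c b
    rw [mem_iff q, mem_iff q] at h
    have h4 : rr q (M.arc b).s < rr q (M.arc c).t := by
      clear hA hB hNP
      unfold Cyc at h
      grind
    intro y
    have e6 := rr_nonneg q y
    rw [mem_iff q, mem_iff q, mem_iff q, q0]
    clear hA hB hNP h hab hac
    unfold Cyc
    grind
  · exfalso
    push Not at hex
    obtain ⟨z, hz1, hz2⟩ := Order.exists_between_finsets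
      (insert 0 ((Finset.univ.filter fun c => c ∈ S ∧ c ≠ a ∧ (M.arc a).t ∈ (M.arc c).pts).image
        fun c => rr q (M.arc c).s))
      (insert (rr q (M.arc a).t)
        ((Finset.univ.filter fun c => c ∈ S ∧ c ≠ a ∧ (M.arc a).s ∈ (M.arc c).pts).image
        fun c => rr q (M.arc c).t)) (by
        intro x hx y hy
        simp only [Finset.mem_insert, Finset.mem_image, Finset.mem_filter, Finset.mem_univ,
          true_and] at hx hy
        rcases hx with rfl | ⟨c, ⟨hc, hca, hac⟩, rfl⟩ <;>
        rcases hy with rfl | ⟨b, ⟨hb, hba, hab⟩, rfl⟩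
        · exact T0
        · exact (hA b hba hab).2.2
        · exact (hB c hca hac).2.1
        · exact hex b hb c hc hba hca hab hac)
    simp only [Finset.mem_insert, Finset.mem_image, Finset.mem_filter, Finset.mem_univ,
          true_and] at hz1 hz2
    have z0 : 0 < z := hz1 0 (Or.inl rfl)
    have zT := hz2 _ (Or.inl rfl)
    obtain ⟨x, rfl⟩ := rr_surj q (y := z) z0.le (by linarith)
    refine hno ⟨x, fun v hv => ?_⟩
    rw [mem_iff q]
    by_cases hva : v = a
    · subst hva
      rw [q0]
      exact Or.inl ⟨z0, zT⟩
    · rcases hP.end_mem hva (hS v hv a ha) with h | h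
      · have h1 := hA v hva h
        have h2 := hz2 _ (Or.inr ⟨v, ⟨hv, hva, h⟩, rfl⟩)
        exact Or.inr (Or.inl ⟨h2, by linarith⟩)
      · have h1 := hB v hva h
        have h2 := hz1 _ (Or.inr ⟨v, ⟨hv, hva, h⟩, rfl⟩)
        exact Or.inl ⟨h2, by linarith⟩

end CAModel

/-! ### Interval graphs from two nested cliques -/

lemma interval_of_nat {V : Type} [Fintype V] (G : SimpleGraph V) (l r : V → ℕ) (L : ℕ)
    (hlr : ∀ u, l u < r u) (hrL : ∀ u, r u < L) (hl : Function.Injective l)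
    (hr : Function.Injective r) (hne : ∀ u v, l u ≠ r v)
    (hadj : ∀ u v, G.Adj u v ↔ u ≠ v ∧ l u < r v ∧ l v < r u) : IsIntervalGraph G := by
  have key : ∀ n : ℕ, n < L → rr 0 (((n : ℝ) / L : ℝ) : Circ) = (n : ℝ) / L := by
    intro n hn
    have hL : (0:ℝ) < L := by exact_mod_cast (Nat.zero_le n).trans_lt hn
    have h2 : (n : ℝ) < L := by exact_mod_cast hn
    have := rr_of_real 0 (y := (n : ℝ) / L) (by positivity) (by rw [div_lt_one hL]; exact h2)
    rwa [zero_add] at this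
  have inj : ∀ m n : ℕ, m < L → n < L →
      (((m : ℝ) / L : ℝ) : Circ) = (((n : ℝ) / L : ℝ) : Circ) → m = n := by
    intro m n hm hn h
    have hL : (L:ℝ) ≠ 0 := by
      have : 0 < L := (Nat.zero_le n).trans_lt hn
      positivity
    have h1 := key m hm
    rw [h, key n hn] at h1
    have h2 : (n : ℝ) = m := by field_simp at h1; exact h1
    exact_mod_cast h2.symm
  have hl' : ∀ u, l u < L := fun u => (hlr u).trans (hrL u)
  let M : CAModel V :=
    { arc := fun u => ⟨(((l u : ℕ) : ℝ) / L : ℝ), (((r u : ℕ) : ℝ) / L : ℝ)⟩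
      endpoints_distinct := by
        rintro ⟨u, bu⟩ ⟨v, bv⟩ h
        cases bu <;> cases bv <;> simp only [if_true, if_false, Bool.false_eq_true] at h
        · rw [hr (inj _ _ (hrL u) (hrL v) h)]
        · exact absurd (inj _ _ (hrL u) (hl' v) h).symm (hne _ _)
        · exact absurd (inj _ _ (hl' u) (hrL v) h) (hne _ _)
        · rw [hl (inj _ _ (hl' u) (hl' v) h)] }
  have hs : ∀ u, rr 0 (M.arc u).s = (l u : ℝ) / L := fun u => key _ (hl' u)
  have ht : ∀ u, rr 0 (M.arc u).t = (r u : ℝ) / L := fun u => key _ (hrL u)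
  have hmem : ∀ u x, x ∈ (M.arc u).pts ↔ (l u : ℝ) / L < rr 0 x ∧ rr 0 x < (r u : ℝ) / L := by
    intro u x
    rw [mem_iff 0, hs, ht]
    have hL : (0:ℝ) < L := by exact_mod_cast (Nat.zero_le _).trans_lt (hrL u)
    have : (l u : ℝ) / L < (r u : ℝ) / L := by
      gcongr
      exact_mod_cast hlr u
    unfold Cyc
    grind
  refine ⟨M, ⟨0, fun v hv => ?_⟩, fun u v => ?_⟩
  · rw [hmem, rr_self] at hv
    have : (0:ℝ) ≤ (l v : ℝ) / L := by positivity
    linarith [hv.1]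
  · rw [hadj]
    refine and_congr_right fun huv => ?_
    rw [M.inter_iff huv, hmem, hmem, hs, hs]
    have hL : (0:ℝ) < L := by exact_mod_cast (Nat.zero_le _).trans_lt (hrL u)
    simp only [div_lt_div_iff_of_pos_right hL, Nat.cast_lt]
    have h1 := hlr u
    have h2 := hlr v
    have h3 : l u ≠ l v := fun h => huv (hl h)
    omega

lemma interval_of_chain {V : Type} [Fintype V] (G : SimpleGraph V) (P : V → Prop)
    (hP : ∀ u v, P u → P v → u ≠ v → G.Adj u v)
    (hQ : ∀ u v, ¬ P u → ¬ P v → u ≠ v → G.Adj u v)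
    (hch : ∀ p1 p2 q1 q2, P p1 → P p2 → ¬ P q1 → ¬ P q2 → G.Adj p1 q1 → G.Adj p2 q2 →
      G.Adj p1 q2 ∨ G.Adj p2 q1) : IsIntervalGraph G := by
  classical
  obtain ⟨N, hN⟩ : ∃ N, N = Fintype.card V := ⟨_, rfl⟩
  obtain ⟨e, he, hei⟩ : ∃ e : V → ℕ, (∀ v, e v < N) ∧ Function.Injective e := by
    refine ⟨fun v => (Fintype.equivFin V v : ℕ), fun v => hN ▸ (Fintype.equivFin V v).2, ?_⟩
    intro u v h
    exact (Fintype.equivFin V).injective (Fin.ext h)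
  let nb : V → Finset V := fun p => Finset.univ.filter fun q => ¬ P q ∧ G.Adj p q
  obtain ⟨d, hd⟩ : ∃ d : V → ℕ, d = fun p => (nb p).card := ⟨_, rfl⟩
  have hdN : ∀ p, d p ≤ N := by
    intro p
    rw [hd, hN]
    exact Finset.card_le_univ _
  have hnest : ∀ p p' q, P p → P p' → ¬ P q → G.Adj p q → d p ≤ d p' → G.Adj p' q := by
    intro p p' q hp hp' hq hpq hdd
    by_contra hcon
    have hsub : nb p' ⊂ nb p := by
      refine Finset.ssubset_iff_subset_ne.2 ⟨?_, ?_⟩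
      · intro x hx
        simp only [nb, Finset.mem_filter, Finset.mem_univ, true_and] at hx ⊢
        refine ⟨hx.1, ?_⟩
        rcases hch p p' q x hp hp' hq hx.1 hpq hx.2 with h | h
        · exact h
        · exact absurd h hcon
      · intro h
        have : q ∈ nb p := by simp [nb, hq, hpq]
        rw [← h] at this
        simp [nb, hcon] at this
    have := Finset.card_lt_card hsub
    rw [hd] at hdd
    simp only at hdd
    omega
  have hg : ∀ q, ∃ g, g ≤ N + 1 ∧ (¬ P q → ∀ p, P p → (G.Adj p q ↔ g ≤ d p)) := by
    intro q
    by_cases hq : P q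
    · exact ⟨0, by omega, fun h => absurd hq h⟩
    by_cases hne : (Finset.univ.filter fun p => P p ∧ G.Adj p q).Nonempty
    · obtain ⟨p0, hp0, hmin⟩ := Finset.exists_min_image _ d hne
      simp only [Finset.mem_filter, Finset.mem_univ, true_and] at hp0 hmin
      refine ⟨d p0, (hdN p0).trans (by omega), fun _ p hp => ⟨fun h => hmin p ⟨hp, h⟩, fun h => ?_⟩⟩
      exact hnest p0 p q hp0.1 hp hq hp0.2 h
    · refine ⟨N + 1, le_rfl, fun _ p hp => ⟨fun h => ?_, fun h => ?_⟩⟩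
      · exact absurd ⟨p, by simp [hp, h]⟩ hne
      · have := hdN p
        omega
  choose g hgN hgP using hg
  have mono : ∀ a b : ℕ, a + 1 ≤ b → N * a + N ≤ N * b := by
    intro a b h
    have := Nat.mul_le_mul_left N h
    rwa [Nat.mul_succ] at this
  have mono' : ∀ a b : ℕ, a ≤ b → N * a ≤ N * b := fun a b h => Nat.mul_le_mul_left N h
  have einj : ∀ {a b : ℕ} {u v : V}, 2 * (N * a) + e u = 2 * (N * b) + e v → u = v := by
    intro a b u v h
    have h1 := he u
    have h2 := he v
    rcases lt_trichotomy a b with hab | hab | hab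
    · have := mono a b hab
      omega
    · subst hab
      exact hei (by omega)
    · have := mono b a hab
      omega
  refine interval_of_nat G
    (fun u => if P u then e u else 2 * (N * g u) + N + e u)
    (fun u => if P u then 2 * (N * d u) + 2 * N + e u else 2 * (N * (N + 2)) + 2 * N + e u)
    (2 * (N * (N + 2)) + 4 * N + 1) ?_ ?_ ?_ ?_ ?_ ?_
  · intro u
    have h1 := he u
    have h2 := mono' _ _ (hgN u)
    have h3 := mono (N + 1) (N + 2) le_rfl
    try dsimp only
    split_ifs <;> omega
  · intro u
    have h1 := he u
    have h2 := mono' _ _ (hdN u)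
    have h3 := mono' N (N + 2) (by omega)
    try dsimp only
    split_ifs <;> omega
  · intro u v h
    have h1 := he u
    have h2 := he v
    try dsimp only at h
    split_ifs at h
    · exact hei h
    · omega
    · omega
    · exact einj (a := g u) (b := g v) (by omega)
  · intro u v h
    have h1 := he u
    have h2 := he v
    have h3 := mono' _ _ (hdN u)
    have h4 := mono' _ _ (hdN v)
    have h5 := mono N (N + 2) (by omega)
    try dsimp only at h
    split_ifs at h
    · exact einj (a := d u) (b := d v) (by omega)
    · omega
    · omega
    · exact hei (by omega)
  · intro u v h
    have h1 := he u
    have h2 := he v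
    have h3 := mono' _ _ (hgN u)
    have h5 := mono (N + 1) (N + 2) (by omega)
    try dsimp only at h
    split_ifs at h
    · omega
    · omega
    · rcases Nat.lt_or_ge (d v) (g u) with h6 | h6
      · have := mono _ _ h6
        omega
      · have := mono' _ _ h6
        omega
    · omega
  · intro u v
    have h1 := he u
    have h2 := he v
    have h3 := mono' _ _ (hgN u)
    have h4 := mono' _ _ (hgN v)
    have h5 := mono (N + 1) (N + 2) (by omega)
    have cross : ∀ p q, P p → ¬ P q →
        (G.Adj p q ↔ 2 * (N * g q) + N + e q < 2 * (N * d p) + 2 * N + e p) := by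
      intro p q hp hq
      have f1 := he p
      have f2 := he q
      rw [hgP q hq p hp]
      rcases Nat.lt_or_ge (d p) (g q) with h6 | h6
      · have := mono _ _ h6
        constructor <;> intro <;> omega
      · have := mono' _ _ h6
        constructor <;> intro <;> omega
    by_cases hu : P u <;> by_cases hv : P v <;> simp only [hu, hv, if_true, if_false]
    · refine ⟨fun h => ⟨h.ne, by omega, by omega⟩, fun h => hP u v hu hv h.1⟩
    · refine ⟨fun h => ⟨h.ne, by omega, (cross u v hu hv).1 h⟩, fun h => (cross u v hu hv).2 h.2.2⟩
    · refine ⟨fun h => ⟨h.ne, (cross v u hv hu).1 h.symm, by omega⟩,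
        fun h => ((cross v u hv hu).2 h.2.1).symm⟩
    · refine ⟨fun h => ⟨h.ne, by omega, by omega⟩, fun h => hQ u v hu hv h.1⟩

/-- Every proper circular-arc model of a PHCA graph that is not an
interval graph is itself a PHCA model (i.e. it is also Helly). -/
theorem stmt_10 {V : Type} [Fintype V] (G : SimpleGraph V)
    (hG : IsPHCAGraph G) (hni : ¬ IsIntervalGraph G)
    {W : Type} [Fintype W] (M : CAModel W) (hMP : M.Proper)
    (hM : Nonempty (M.interGraph ≃g G)) :
    M.Helly := by
  classical
  obtain ⟨φ⟩ := hM
  obtain ⟨N, hNP, hNH, hNG⟩ := hG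
  have hadj : ∀ u v, u ≠ v → (M.Inter u v ↔ G.Adj (φ u) (φ v)) := by
    intro u v huv
    rw [φ.map_adj_iff, CAModel.interGraph, SimpleGraph.fromRel_adj]
    constructor
    · exact fun h => ⟨huv, Or.inl h⟩
    · rintro ⟨-, h | h⟩
      · exact h
      · exact M.inter_symm h
  have htr : ∀ u v, M.Inter u v ↔ N.Inter (φ u) (φ v) := by
    intro u v
    by_cases huv : u = v
    · subst huv
      exact ⟨fun _ => N.inter_self _, fun _ => M.inter_self _⟩
    · rw [hadj u v huv, hNG]
      exact ⟨fun h => h.2, fun h => ⟨fun h' => huv (φ.injective h'), h⟩⟩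
  have noW : ∀ {c x1 x2 x3 x4 : W}, M.Inter c x1 → M.Inter c x2 → M.Inter c x3 → M.Inter c x4 →
      M.Inter x1 x2 → M.Inter x2 x3 → M.Inter x3 x4 → M.Inter x4 x1 →
      ¬ M.Inter x1 x3 → ¬ M.Inter x2 x4 → False := by
    intro c x1 x2 x3 x4
    simp only [htr]
    exact N.no_wheel hNP hNH
  have hU : ∀ u, ∃ w, ¬ M.Inter w u := by
    intro b
    by_contra hb
    push Not at hb
    apply hni
    have hQmem : ∀ u, ¬ (u = b ∨ (M.arc b).s ∈ (M.arc u).pts) → (M.arc b).t ∈ (M.arc u).pts := by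
      intro u hu
      push Not at hu
      exact (hMP.end_mem hu.1 (hb u)).resolve_left hu.2
    have hadj' : ∀ u v, u ≠ v → M.Inter (φ.symm u) (φ.symm v) → G.Adj u v := by
      intro u v huv h
      have := (hadj (φ.symm u) (φ.symm v) (fun h' => huv (φ.symm.injective h'))).1 h
      simpa using this
    have hadj2 : ∀ u v, G.Adj u v → M.Inter (φ.symm u) (φ.symm v) := by
      intro u v h
      refine (hadj (φ.symm u) (φ.symm v) (fun h' => h.ne (φ.symm.injective h'))).2 ?_
      simpa using h
    refine interval_of_chain G
      (fun v => φ.symm v = b ∨ (M.arc b).s ∈ (M.arc (φ.symm v)).pts) ?_ ?_ ?_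
    · intro u v hu hv huv
      apply hadj' u v huv
      rcases hu with hu | hu
      · rw [hu]
        exact M.inter_symm (hb _)
      rcases hv with hv | hv
      · rw [hv]
        exact hb _
      exact ⟨_, hu, hv⟩
    · intro u v hu hv huv
      exact hadj' u v huv ⟨_, hQmem _ hu, hQmem _ hv⟩
    · intro p1 p2 q1 q2 hp1 hp2 hq1 hq2 h1 h2
      by_contra hcon
      push Not at hcon
      have n12 : ¬ M.Inter (φ.symm p1) (φ.symm q2) := fun h =>
        hcon.1 (hadj' _ _ (by rintro rfl; exact hq2 hp1) h)
      have n21 : ¬ M.Inter (φ.symm p2) (φ.symm q1) := fun h =>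
        hcon.2 (hadj' _ _ (by rintro rfl; exact hq1 hp2) h)
      have b1 : φ.symm p1 ≠ b := fun h => n12 (by rw [h]; exact M.inter_symm (hb _))
      have b2 : φ.symm p2 ≠ b := fun h => n21 (by rw [h]; exact M.inter_symm (hb _))
      exact noW (M.inter_symm (hb (φ.symm p1))) (M.inter_symm (hb (φ.symm q1)))
        (M.inter_symm (hb (φ.symm q2))) (M.inter_symm (hb (φ.symm p2)))
        (hadj2 _ _ h1) ⟨_, hQmem _ hq1, hQmem _ hq2⟩ (M.inter_symm (hadj2 _ _ h2))
        ⟨_, hp2.resolve_left b2, hp1.resolve_left b1⟩ n12 (fun h => n21 (M.inter_symm h))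
  intro S hS
  by_contra hno
  obtain ⟨a, b, c, hab, hbc, hac, hcov⟩ := M.exists_cover hMP hU S hS hno
  have hba := M.inter_symm hab
  have hcb := M.inter_symm hbc
  have hca := M.inter_symm hac
  have two : ∀ {x y z w : W}, (∀ p, p ∈ (M.arc x).pts ∨ p ∈ (M.arc y).pts ∨ p ∈ (M.arc z).pts) →
      M.Inter z x → ¬ M.Inter w x → M.Inter w y := by
    intro x y z w hc hzx hwx
    by_contra hwy
    refine hMP.no_subset hwx hzx fun p hp => ?_
    rcases hc p with h | h | h
    · exact absurd ⟨p, hp, h⟩ hwx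
    · exact absurd ⟨p, hp, h⟩ hwy
    · exact h
  obtain ⟨wa, ha⟩ := hU a
  obtain ⟨wb, hb⟩ := hU b
  obtain ⟨wc, hc⟩ := hU c
  have wab : M.Inter wa b := two (fun p => hcov p) hca ha
  have wac : M.Inter wa c := two (z := b) (fun p => by have := hcov p; tauto) hba ha
  have wba : M.Inter wb a := two (z := c) (fun p => by have := hcov p; tauto) hcb hb
  have wbc : M.Inter wb c := two (z := a) (fun p => by have := hcov p; tauto) hab hb
  have wca : M.Inter wc a := two (z := b) (fun p => by have := hcov p; tauto) hbc hc
  have wcb : M.Inter wc b := two (z := a) (fun p => by have := hcov p; tauto) hac hc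
  simp only [htr] at *
  exact N.no_sun hNP hNH hab hbc hac wca wcb hc wab wac ha wbc wba hb
end
end

section
/- A unit circular-arc (UCA) graph is a unit Helly circular-arc (UHCA) graph if and only if it contains no induced subgraph isomorphic to the 4-wheel W_4. -/
open Set

noncomputable section

/-! ### Geometry of the circle in real coordinates -/

lemma circ_eq_iff (a b : ℝ) : (a : Circ) = (b : Circ) ↔ ∃ k : ℤ, a = b + k := by
  rw [← sub_eq_zero, ← AddCircle.coe_sub, AddCircle.coe_eq_zero_iff]
  constructor
  · rintro ⟨k, hk⟩
    exact ⟨k, by simp at hk; linarith⟩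
  · rintro ⟨k, hk⟩
    exact ⟨k, by simp; linarith⟩

lemma circ_add_int (a : ℝ) (k : ℤ) : ((a + k : ℝ) : Circ) = (a : Circ) :=
  (circ_eq_iff _ _).2 ⟨k, rfl⟩

lemma pts_iff (a l : ℝ) (h0 : 0 < l) (h1 : l < 1) (x : Circ) :
    x ∈ Arc.pts ⟨(a : Circ), ((a + l : ℝ) : Circ)⟩ ↔
      ∃ r : ℝ, (r : Circ) = x ∧ a < r ∧ r < a + l := by
  induction x using QuotientAddGroup.induction_on with
  | H b =>
    have e1 : (QuotientAddGroup.mk b : Circ) ∈ Arc.pts ⟨(a : Circ), ((a + l : ℝ) : Circ)⟩ ↔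
        ¬ btw (a : Circ) ((a + l : ℝ) : Circ) (b : Circ) := by
      show sbtw (a : Circ) (b : Circ) ((a + l : ℝ) : Circ) ↔ _
      rw [sbtw_iff_not_btw, btw_cyclic, btw_cyclic, btw_cyclic, btw_cyclic]
    rw [e1]
    have e2 := QuotientAddGroup.btw_coe_iff (p := (1:ℝ)) (x₁ := a) (x₂ := a + l) (x₃ := b)
    rw [show (btw (a : Circ) ((a + l : ℝ) : Circ) (b : Circ)) ↔ _ from e2]
    have e3 : toIcoMod (one_pos : (0:ℝ) < 1) a (a + l) = a + l := by
      rw [toIcoMod_eq_self]; constructor <;> linarith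
    rw [e3, not_le]
    have hm := toIocMod_mem_Ioc (one_pos : (0:ℝ) < 1) a b
    have hs := self_sub_toIocMod (one_pos : (0:ℝ) < 1) a b
    constructor
    · intro h
      refine ⟨_, ?_, hm.1, h⟩
      apply Eq.symm
      refine (circ_eq_iff _ _).2 ⟨toIocDiv (one_pos : (0:ℝ) < 1) a b, ?_⟩
      simp only [zsmul_eq_mul, mul_one] at hs
      linarith
    · rintro ⟨r, hr, h2, h3⟩
      obtain ⟨k, hk⟩ := (circ_eq_iff _ _).1 hr
      have : toIocMod (one_pos : (0:ℝ) < 1) a b = r := by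
        rw [toIocMod_eq_iff]
        refine ⟨⟨h2, by linarith⟩, -k, ?_⟩
        simp; linarith
      rw [this]; exact h3

lemma length_mk (a l : ℝ) (h0 : 0 < l) (h1 : l < 1) :
    Arc.length ⟨(a : Circ), ((a + l : ℝ) : Circ)⟩ = l := by
  unfold Arc.length
  have : ((a + l : ℝ) : Circ) - (a : Circ) = (l : Circ) := by
    rw [← AddCircle.coe_sub]; congr 1; ring
  simp only [this]
  exact AddCircle.equivIoc_coe_of_mem ⟨h0, by linarith⟩

lemma inter_mk (a b l : ℝ) (h0 : 0 < l) (h1 : l < 1) :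
    (Arc.pts ⟨(a : Circ), ((a + l : ℝ) : Circ)⟩ ∩
      Arc.pts ⟨(b : Circ), ((b + l : ℝ) : Circ)⟩).Nonempty ↔ ∃ k : ℤ, |a - b + k| < l := by
  constructor
  · rintro ⟨x, hx, hy⟩
    obtain ⟨r, hr, h2, h3⟩ := (pts_iff a l h0 h1 x).1 hx
    obtain ⟨r', hr', h2', h3'⟩ := (pts_iff b l h0 h1 x).1 hy
    obtain ⟨k, hk⟩ := (circ_eq_iff r' r).1 (hr'.trans hr.symm)
    refine ⟨k, ?_⟩
    rw [abs_lt]; constructor <;> linarith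
  · rintro ⟨k, hk⟩
    rw [abs_lt] at hk
    refine ⟨(((a + (b - k) + l) / 2 : ℝ) : Circ), ?_, ?_⟩
    · rw [pts_iff a l h0 h1]
      exact ⟨_, rfl, by linarith, by linarith⟩
    · rw [pts_iff b l h0 h1]
      exact ⟨_, circ_add_int _ k, by linarith, by linarith⟩

/-- The model `M` has arcs `(τ v, τ v + l)`. -/
def UnitRep {V : Type} [Fintype V] (M : CAModel V) (l : ℝ) (τ : V → ℝ) : Prop :=
  ∀ v, M.arc v = ⟨(τ v : Circ), ((τ v + l : ℝ) : Circ)⟩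

lemma UnitRep.inter_iff {V : Type} [Fintype V] {M : CAModel V} {l : ℝ} {τ : V → ℝ}
    (h : UnitRep M l τ) (h0 : 0 < l) (h1 : l < 1) (u v : V) :
    M.Inter u v ↔ ∃ k : ℤ, |τ u - τ v + k| < l := by
  unfold CAModel.Inter
  rw [h u, h v]
  exact inter_mk _ _ _ h0 h1

lemma UnitRep.mem_iff {V : Type} [Fintype V] {M : CAModel V} {l : ℝ} {τ : V → ℝ}
    (h : UnitRep M l τ) (h0 : 0 < l) (h1 : l < 1) (v : V) (x : Circ) :
    x ∈ (M.arc v).pts ↔ ∃ r : ℝ, (r : Circ) = x ∧ τ v < r ∧ r < τ v + l := by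
  rw [h v]
  exact pts_iff _ _ h0 h1 x

/-- If all differences of coordinates are less than one, two unit arcs intersect iff
the coordinates are close or almost one turn apart. -/
lemma UnitRep.inter_iff' {V : Type} [Fintype V] {M : CAModel V} {l : ℝ} {τ : V → ℝ}
    (h : UnitRep M l τ) (h0 : 0 < l) (h1 : l < 1) (u v : V) (hd : |τ u - τ v| < 1) :
    M.Inter u v ↔ |τ u - τ v| < l ∨ 1 - l < |τ u - τ v| := by
  rw [h.inter_iff h0 h1]
  rw [abs_lt] at hd
  constructor
  · rintro ⟨k, hk⟩
    rw [abs_lt] at hk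
    have k1 : (k : ℝ) < 2 := by linarith
    have k2 : (-2 : ℝ) < k := by linarith
    have k1' : k < 2 := by exact_mod_cast k1
    have k2' : -2 < k := by exact_mod_cast k2
    obtain rfl | rfl | rfl : k = -1 ∨ k = 0 ∨ k = 1 := by omega
    · right; rw [lt_abs]; left; push_cast at hk; linarith
    · left; rw [abs_lt]; push_cast at hk; constructor <;> linarith
    · right; rw [lt_abs]; right; push_cast at hk; linarith
  · rintro (h2 | h2)
    · exact ⟨0, by simpa using h2⟩
    · rcases lt_abs.1 h2 with h3 | h3
      · exact ⟨-1, by rw [abs_lt]; push_cast; constructor <;> linarith⟩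
      · exact ⟨1, by rw [abs_lt]; push_cast; constructor <;> linarith⟩

/-- Coordinates centred at a vertex `h`. -/
lemma exists_rep {V : Type} [Fintype V] (M : CAModel V) (hM : M.IsUnit) (h : V) :
    ∃ (l : ℝ) (τ : V → ℝ), 0 < l ∧ l < 1 ∧ UnitRep M l τ ∧
      (∀ v, τ h - 1 / 2 ≤ τ v ∧ τ v < τ h + 1 / 2) ∧
      (∀ u v, u ≠ v → ∀ k : ℤ, τ u + l ≠ τ v + k) := by
  obtain ⟨c, hc⟩ := QuotientAddGroup.mk_surjective (M.arc h).s
  have key : ∀ v, ∃ t : ℝ, (t : Circ) = (M.arc v).s ∧ c - 1 / 2 ≤ t ∧ t < c + 1 / 2 := by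
    intro v
    have := (AddCircle.equivIco (1:ℝ) (c - 1/2) (M.arc v).s).2
    exact ⟨_, AddCircle.coe_equivIco (p := (1:ℝ)) (a := c - 1/2), this.1, by linarith [this.2]⟩
  choose τ h1 h2 h3 using key
  have hτ : τ h = c := by
    refine (AddCircle.coe_eq_coe_iff_of_mem_Ico (p := (1:ℝ)) (a := c - 1/2)
      ⟨h2 h, by linarith [h3 h]⟩ ⟨by linarith, by linarith⟩).1 ?_
    rw [h1 h]; exact hc.symm
  have hl := (AddCircle.equivIoc (1:ℝ) 0 ((M.arc h).t - (M.arc h).s)).2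
  have hlen : ∀ v, (((M.arc h).length : ℝ) : Circ) = (M.arc v).t - (M.arc v).s := by
    intro v
    rw [hM h v]
    exact AddCircle.coe_equivIoc (p := (1:ℝ)) (a := 0)
  have ht : ∀ v, ((τ v + (M.arc h).length : ℝ) : Circ) = (M.arc v).t := by
    intro v
    rw [AddCircle.coe_add, hlen v, h1 v]; abel
  have hne : ∀ u v, (M.arc u).t ≠ (M.arc v).s := by
    intro u v e
    have := M.endpoints_distinct (a₁ := (u, false)) (a₂ := (v, true)) (by simpa using e)
    simp at this
  refine ⟨(M.arc h).length, τ, hl.1, ?_, ?_, ?_, ?_⟩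
  · refine lt_of_le_of_ne (hl.2.trans_eq (zero_add 1)) ?_
    intro e
    apply hne h h
    rw [← ht h, ← h1 h, e]
    exact_mod_cast circ_add_int (τ h) 1
  · intro v
    rw [h1 v, ht v]
  · intro v
    rw [hτ]; exact ⟨h2 v, h3 v⟩
  · intro u v _ k e
    apply hne u v
    rw [← ht u, ← h1 v, e, circ_add_int]

/-! ### Wheels -/

lemma wheel_embed {V : Type} {G : SimpleGraph V} (p0 p1 p2 p3 h : V)
    (h01 : G.Adj p0 p1) (h12 : G.Adj p1 p2) (h23 : G.Adj p2 p3) (h30 : G.Adj p3 p0)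
    (h02 : ¬ G.Adj p0 p2) (h13 : ¬ G.Adj p1 p3) (n02 : p0 ≠ p2) (n13 : p1 ≠ p3)
    (k0 : G.Adj h p0) (k1 : G.Adj h p1) (k2 : G.Adj h p2) (k3 : G.Adj h p3) :
    Nonempty (wheel 4 ↪g G) := by
  have e01 := h01.ne
  have e12 := h12.ne
  have e23 := h23.ne
  have e30 := h30.ne
  have f0 := k0.ne
  have f1 := k1.ne
  have f2 := k2.ne
  have f3 := k3.ne
  refine ⟨⟨⟨Sum.elim ![p0, p1, p2, p3] (fun _ => h), ?_⟩, ?_⟩⟩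
  · rintro (i | i) (j | j) hij
    · fin_cases i <;> fin_cases j <;> simp_all
    · fin_cases i <;> simp_all
    · fin_cases j <;> simp_all
    · rfl
  · intro a b
    change G.Adj (Sum.elim ![p0, p1, p2, p3] (fun _ => h) a)
      (Sum.elim ![p0, p1, p2, p3] (fun _ => h) b) ↔ _
    rcases a with (i | i) <;> rcases b with (j | j)
    · fin_cases i <;> fin_cases j <;> simp_all [wheel, G.adj_comm]
    · fin_cases i <;> simp_all [wheel, G.adj_comm]
    · fin_cases j <;> simp_all [wheel, G.adj_comm]
    · simp [wheel]

lemma wheel_extract {V : Type} {G : SimpleGraph V} (f : wheel 4 ↪g G) :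
    ∃ p0 p1 p2 p3 h : V, G.Adj p0 p1 ∧ G.Adj p1 p2 ∧ G.Adj p2 p3 ∧ G.Adj p3 p0 ∧
      ¬ G.Adj p0 p2 ∧ ¬ G.Adj p1 p3 ∧ p0 ≠ p2 ∧ p1 ≠ p3 ∧
      G.Adj h p0 ∧ G.Adj h p1 ∧ G.Adj h p2 ∧ G.Adj h p3 := by
  refine ⟨f (Sum.inl 0), f (Sum.inl 1), f (Sum.inl 2), f (Sum.inl 3), f (Sum.inr ()), ?_⟩
  simp only [f.map_adj_iff, ne_eq, f.injective.eq_iff]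
  simp [wheel]

/-! ### Co-bipartite graphs with a universal vertex -/

lemma chain_repr {V : Type} [Fintype V] (G : SimpleGraph V) (hW : IsEmpty (wheel 4 ↪g G))
    (u : V) (hu : ∀ v, v ≠ u → G.Adj u v) (P : V → Prop)
    (c1 : ∀ a b, a ≠ b → P a → P b → G.Adj a b)
    (c2 : ∀ a b, a ≠ b → ¬ P a → ¬ P b → G.Adj a b) :
    ∃ (pos : V → ℤ) (K : ℤ), 0 ≤ K ∧ ∀ a b, a ≠ b → (G.Adj a b ↔ |pos a - pos b| ≤ K) := by
  classical
  let N : V → Finset V := fun x => Finset.univ.filter fun y => ¬ P y ∧ ¬ G.Adj x y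
  have hN : ∀ x y, y ∈ N x ↔ ¬ P y ∧ ¬ G.Adj x y := by intro x y; simp [N]
  let n := Fintype.card V
  have hp : ∀ x, (N x).card ≤ n := fun x => Finset.card_le_univ _
  have nested : ∀ x x', P x → P x' → N x ⊆ N x' ∨ N x' ⊆ N x := by
    intro x x' hx hx'
    by_contra hcon
    push Not at hcon
    obtain ⟨h1, h2⟩ := hcon
    obtain ⟨y, hy, hy'⟩ := Finset.not_subset.1 h1
    obtain ⟨z, hz, hz'⟩ := Finset.not_subset.1 h2
    rw [hN] at hy hy' hz hz'
    have ay : G.Adj x' y := by by_contra h; exact hy' ⟨hy.1, h⟩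
    have az : G.Adj x z := by by_contra h; exact hz' ⟨hz.1, h⟩
    have nyz : y ≠ z := by rintro rfl; exact hz' ⟨hz.1, hy.2⟩
    have nxx : x ≠ x' := by rintro rfl; exact hy.2 ay
    have nxy : x ≠ y := by rintro rfl; exact hy.1 hx
    have nxz : x' ≠ z := by rintro rfl; exact hz.1 hx'
    have ux : x ≠ u := by rintro rfl; exact hy.2 (hu _ nxy.symm)
    have ux' : x' ≠ u := by rintro rfl; exact hz.2 (hu _ nxz.symm)
    have uy : y ≠ u := by rintro rfl; exact hy.2 (hu _ nxy).symm
    have uz : z ≠ u := by rintro rfl; exact hz.2 (hu _ nxz).symm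
    obtain ⟨f⟩ := wheel_embed (G := G) x x' y z u (c1 _ _ nxx hx hx') ay
      (c2 _ _ nyz hy.1 hz.1) az.symm hy.2 hz.2 nxy nxz (hu _ ux) (hu _ ux') (hu _ uy) (hu _ uz)
    exact hW.false f
  let Q : V → Set ℕ := fun y => {k | k = n + 1 ∨ ∃ x, P x ∧ ¬ G.Adj x y ∧ k = (N x).card}
  let q : V → ℕ := fun y => sInf (Q y)
  have hQ : ∀ y, n + 1 ∈ Q y := fun y => Or.inl rfl
  have hq : ∀ y, q y ≤ n + 1 := fun y => Nat.sInf_le (hQ y)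
  have hqm : ∀ y, q y ∈ Q y := fun y => Nat.sInf_mem ⟨_, hQ y⟩
  have thr : ∀ x y, P x → ¬ P y → (¬ G.Adj x y ↔ q y ≤ (N x).card) := by
    intro x y hx hy
    constructor
    · intro h
      exact Nat.sInf_le (Or.inr ⟨x, hx, h, rfl⟩)
    · intro h
      rcases hqm y with h2 | ⟨x0, hx0, ha, h2⟩
      · have := hp x; omega
      · have hy0 : y ∈ N x0 := (hN _ _).2 ⟨hy, ha⟩
        have hsub : N x0 ⊆ N x := by
          rcases nested x0 x hx0 hx with h3 | h3
          · exact h3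
          · exact (Finset.eq_of_subset_of_card_le h3 (by omega)).symm.subset
        exact ((hN _ _).1 (hsub hy0)).2
  refine ⟨fun v => if P v then -((N v).card : ℤ) else (3 * n + 5) - (q v : ℤ), 3 * n + 4,
    by positivity, ?_⟩
  intro a b hab
  have ha := hp a
  have hb := hp b
  have ha' := hq a
  have hb' := hq b
  by_cases pa : P a <;> by_cases pb : P b
  · simp only [pa, pb, if_true]
    refine iff_of_true (c1 _ _ hab pa pb) ?_
    rw [abs_le]; constructor <;> omega
  · simp only [pa, pb, if_true, if_false]
    rw [← not_iff_not, thr a b pa pb, abs_le]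
    omega
  · simp only [pa, pb, if_true, if_false]
    rw [G.adj_comm, ← not_iff_not, thr b a pb pa, abs_le]
    omega
  · simp only [pa, pb, if_false]
    refine iff_of_true (c2 _ _ hab pa pb) ?_
    rw [abs_le]; constructor <;> omega

/-! ### Unit interval graphs are UHCA graphs -/

lemma uhca_of_int {V : Type} [Fintype V] (G : SimpleGraph V) (pos : V → ℤ) (K : ℤ)
    (hK : 0 ≤ K) (h : ∀ a b, a ≠ b → (G.Adj a b ↔ |pos a - pos b| ≤ K)) :
    IsUHCAGraph G := by
  classical
  obtain ⟨e, einj, e0, e1⟩ : ∃ e : V → ℝ, Function.Injective e ∧ (∀ v, 0 ≤ e v) ∧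
      ∀ v, e v < 1 / 4 := by
    let g := Fintype.equivFin V
    refine ⟨fun v => ((g v : ℕ) : ℝ) / (4 * (Fintype.card V : ℝ)), ?_, ?_, ?_⟩
    · intro a b hab
      have hc : (0:ℝ) < Fintype.card V := by
        exact_mod_cast Fintype.card_pos_iff.2 ⟨a⟩
      have h2 : ((g a : ℕ) : ℝ) = ((g b : ℕ) : ℝ) := by
        have := hab
        simp only at this
        field_simp at this
        exact this
      exact g.injective (Fin.ext (by exact_mod_cast h2))
    · intro v; positivity
    · intro v
      have hc : (0:ℝ) < Fintype.card V := by
        exact_mod_cast Fintype.card_pos_iff.2 ⟨v⟩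
      have : ((g v : ℕ) : ℝ) < Fintype.card V := by exact_mod_cast (g v).2
      show ((g v : ℕ) : ℝ) / (4 * (Fintype.card V : ℝ)) < 1 / 4
      rw [div_lt_div_iff₀ (by positivity) (by norm_num)]
      linarith
  obtain ⟨B, hB⟩ : ∃ B : ℤ, ∀ v, |pos v| ≤ B :=
    ⟨∑ v, |pos v|, fun v => Finset.single_le_sum (f := fun v => |pos v|)
      (fun i _ => abs_nonneg _) (Finset.mem_univ v)⟩
  let B' : ℤ := max B 0
  have hB1 : ∀ v, |pos v| ≤ B' := fun v => (hB v).trans (le_max_left _ _)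
  have hB0 : (0:ℤ) ≤ B' := le_max_right _ _
  have hB0r : (0:ℝ) ≤ B' := by exact_mod_cast hB0
  have hKr : (0:ℝ) ≤ K := by exact_mod_cast hK
  let D : ℝ := 8 * (B' + K + 2)
  have hD : 0 < D := by positivity
  let τ : V → ℝ := fun v => (pos v + e v) / D
  let l : ℝ := (K + 1 / 2) / D
  have hτD : ∀ v, τ v * D = pos v + e v := fun v => div_mul_cancel₀ _ hD.ne'
  have hlD : l * D = K + 1 / 2 := div_mul_cancel₀ _ hD.ne'
  have l0 : 0 < l := by positivity
  have l1 : l < 1 / 8 := by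
    show (K + 1 / 2) / D < 1 / 8
    rw [div_lt_div_iff₀ hD (by norm_num)]
    show _ < 1 * (8 * ((B':ℝ) + K + 2))
    linarith
  have hposr : ∀ v, -(B' : ℝ) ≤ pos v ∧ (pos v : ℝ) ≤ B' := by
    intro v
    have := abs_le.1 (hB1 v)
    exact ⟨by exact_mod_cast this.1, by exact_mod_cast this.2⟩
  have hτ1 : ∀ v, τ v < 1 / 8 := by
    intro v
    show (pos v + e v) / D < 1 / 8
    rw [div_lt_div_iff₀ hD (by norm_num)]
    show _ < 1 * (8 * ((B':ℝ) + K + 2))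
    linarith [(hposr v).2, e1 v]
  have hτ0 : ∀ v, -(1 / 8) < τ v := by
    intro v
    show _ < (pos v + e v) / D
    rw [lt_div_iff₀ hD]
    show _ * (8 * ((B':ℝ) + K + 2)) < _
    linarith [(hposr v).1, e0 v]
  have coe_inj : ∀ x y : ℝ, -(1/8) < x → x < 1/4 → -(1/8) < y → y < 1/4 →
      (x : Circ) = (y : Circ) → x = y := by
    intro x y a1 a2 a3 a4 hxy
    exact (AddCircle.coe_eq_coe_iff_of_mem_Ico (p := (1:ℝ)) (a := -(1/8))
      ⟨a1.le, by linarith⟩ ⟨a3.le, by linarith⟩).1 hxy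
  have τinj : ∀ u v, τ u = τ v → u = v := by
    intro u v huv
    have h1 : (pos u : ℝ) + e u = pos v + e v := by rw [← hτD, ← hτD, huv]
    have h2 : (pos u : ℝ) < pos v + 1 := by linarith [e0 u, e1 v]
    have h3 : (pos v : ℝ) < pos u + 1 := by linarith [e0 v, e1 u]
    have h2' : pos u < pos v + 1 := by exact_mod_cast h2
    have h3' : pos v < pos u + 1 := by exact_mod_cast h3
    have h4 : pos u = pos v := by omega
    rw [h4] at h1
    exact einj (by linarith)
  have τne : ∀ u v, τ u ≠ τ v + l := by
    intro u v huv
    have h1 : (pos u : ℝ) + e u = pos v + e v + (K + 1 / 2) := by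
      rw [← hτD, ← hτD, ← hlD, huv]; ring
    have h2 : (pos u : ℝ) < pos v + K + 1 := by linarith [e0 u, e1 v]
    have h3 : (pos v : ℝ) + K < pos u := by linarith [e0 v, e1 u]
    have h2' : pos u < pos v + K + 1 := by exact_mod_cast h2
    have h3' : pos v + K < pos u := by exact_mod_cast h3
    omega
  let M : CAModel V :=
    { arc := fun v => ⟨(τ v : Circ), ((τ v + l : ℝ) : Circ)⟩
      endpoints_distinct := by
        rintro ⟨u, b⟩ ⟨v, c⟩ huv
        have a1 := hτ0 u
        have a2 := hτ1 u
        have a3 := hτ0 v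
        have a4 := hτ1 v
        cases b <;> cases c
        · simp only [Bool.false_eq_true, if_false] at huv
          have := coe_inj _ _ (by linarith) (by linarith) (by linarith) (by linarith) huv
          rw [τinj u v (by linarith)]
        · simp only [Bool.false_eq_true, if_false, if_true] at huv
          have := coe_inj _ _ (by linarith) (by linarith) (by linarith) (by linarith) huv
          exact absurd this.symm (τne v u)
        · simp only [Bool.false_eq_true, if_false, if_true] at huv
          have := coe_inj _ _ (by linarith) (by linarith) (by linarith) (by linarith) huv
          exact absurd this (τne u v)
        · simp only [if_true] at huv
          have := coe_inj _ _ (by linarith) (by linarith) (by linarith) (by linarith) huv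
          rw [τinj u v this] }
  have hrep : UnitRep M l τ := fun v => rfl
  have l1' : l < 1 := by linarith
  have hint : ∀ u v, M.Inter u v ↔ |τ u - τ v| < l := by
    intro u v
    have a1 := hτ0 u
    have a2 := hτ1 u
    have a3 := hτ0 v
    have a4 := hτ1 v
    have : |τ u - τ v| < 1 / 4 := by rw [abs_lt]; constructor <;> linarith
    rw [hrep.inter_iff' l0 l1' u v (by linarith)]
    constructor
    · rintro (h | h)
      · exact h
      · linarith
    · exact Or.inl
  refine ⟨M, ?_, ?_, ?_⟩
  · intro u v
    rw [hrep u, hrep v, length_mk _ _ l0 l1', length_mk _ _ l0 l1']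
  · intro S hS
    rcases S.eq_empty_or_nonempty with rfl | hne
    · exact ⟨0, by simp⟩
    · obtain ⟨a, ha, ha'⟩ := Set.exists_min_image S τ S.toFinite hne
      obtain ⟨b, hb, hb'⟩ := Set.exists_max_image S τ S.toFinite hne
      have hab := abs_lt.1 ((hint a b).1 (hS a ha b hb))
      refine ⟨(((τ a + l + τ b) / 2 : ℝ) : Circ), fun v hv => ?_⟩
      have h1 := ha' v hv
      have h2 := hb' v hv
      rw [hrep.mem_iff l0 l1']
      exact ⟨_, rfl, by linarith, by linarith⟩
  · intro u v
    by_cases huv : u = v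
    · subst huv; simp
    · rw [h u v huv, hint, abs_le, abs_lt]
      simp only [ne_eq, huv, not_false_eq_true, true_and]
      have key : (τ u - τ v) * D = (pos u - pos v : ℤ) + (e u - e v) := by
        push_cast; rw [sub_mul, hτD, hτD]; ring
      have := e0 u
      have := e1 u
      have := e0 v
      have := e1 v
      rw [← mul_lt_mul_iff_left₀ hD, ← mul_lt_mul_iff_left₀ (b := τ u - τ v) hD, key, neg_mul, hlD]
      generalize pos u - pos v = m
      constructor
      · rintro ⟨h1, h2⟩
        have h1' : -(K:ℝ) ≤ m := by exact_mod_cast h1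
        have h2' : (m:ℝ) ≤ K := by exact_mod_cast h2
        constructor <;> linarith
      · rintro ⟨h1, h2⟩
        have h1' : -(K:ℝ) - 1 < m := by linarith
        have h2' : (m:ℝ) < K + 1 := by linarith
        have h1'' : -K - 1 < m := by exact_mod_cast h1'
        have h2'' : m < K + 1 := by exact_mod_cast h2'
        constructor <;> omega

/-! ### Main arguments -/

lemma unit_adj {V : Type} [Fintype V] {G : SimpleGraph V} (M : CAModel V) (hM : M.IsUnit)
    (hG : M.IsModelOf G) (h : V) :
    ∃ (l : ℝ) (τ : V → ℝ), 0 < l ∧ l < 1 ∧ UnitRep M l τ ∧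
      (∀ v, τ h - 1 / 2 ≤ τ v ∧ τ v < τ h + 1 / 2) ∧
      (∀ u v, M.Inter u v ↔ |τ u - τ v| < l ∨ 1 - l < |τ u - τ v|) ∧
      (∀ u v, u ≠ v → (G.Adj u v ↔ |τ u - τ v| < l ∨ 1 - l < |τ u - τ v|)) ∧
      (1 / 2 ≤ l → ∀ u v, u ≠ v → G.Adj u v) := by
  obtain ⟨l, τ, l0, l1, hrep, hrange, hdist⟩ := exists_rep M hM h
  have hint : ∀ u v, M.Inter u v ↔ |τ u - τ v| < l ∨ 1 - l < |τ u - τ v| := by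
    intro u v
    refine hrep.inter_iff' l0 l1 u v ?_
    have := hrange u
    have := hrange v
    rw [abs_lt]; constructor <;> linarith
  have hadj : ∀ u v, u ≠ v → (G.Adj u v ↔ |τ u - τ v| < l ∨ 1 - l < |τ u - τ v|) := by
    intro u v huv
    rw [hG u v, hint]
    simp [huv]
  refine ⟨l, τ, l0, l1, hrep, hrange, hint, hadj, ?_⟩
  intro hl u v huv
  rw [hadj u v huv]
  by_contra hcon
  push Not at hcon
  obtain ⟨h1, h2⟩ := hcon
  have h3 : |τ u - τ v| = l := by linarith
  have h4 : l = 1 / 2 := by linarith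
  rcases abs_choice (τ u - τ v) with h5 | h5
  · exact hdist v u huv.symm 0 (by push_cast; linarith)
  · exact hdist u v huv 0 (by push_cast; linarith)

/-- An adjacent pair at signed distance at most one half is closer than `l`. -/
lemma close_of_adj {d l : ℝ} (hl : l < 1 / 2) (h1 : -(1 / 2) ≤ d) (h2 : d ≤ 1 / 2)
    (h : |d| < l ∨ 1 - l < |d|) : -l < d ∧ d < l := by
  have : |d| ≤ 1 / 2 := abs_le.2 ⟨h1, h2⟩
  rcases h with h | h
  · exact abs_lt.1 h
  · linarith

lemma no_wheel_s12 {V : Type} [Fintype V] {G : SimpleGraph V} (hG : IsUHCAGraph G) :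
    IsEmpty (wheel 4 ↪g G) := by
  refine ⟨fun f => ?_⟩
  obtain ⟨M, hM, hH, hG⟩ := hG
  obtain ⟨p0, p1, p2, p3, h, h01, h12, h23, h30, h02, h13, n02, n13, k0, k1, k2, k3⟩ :=
    wheel_extract f
  obtain ⟨l, τ, l0, l1, hrep, hrange, hint, hadj, hcomp⟩ := unit_adj M hM hG h
  have hl : l < 1 / 2 := by
    by_contra hl
    exact h02 (hcomp (not_lt.1 hl) _ _ n02)
  have near : ∀ v, G.Adj h v → -l < τ v - τ h ∧ τ v - τ h < l := by
    intro v hv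
    have := hrange v
    exact close_of_adj hl (by linarith) (by linarith) ((hadj v h hv.ne').1 hv.symm)
  -- a triangle with the hub never covers the circle
  have tri : ∀ a b, G.Adj h a → G.Adj h b → G.Adj a b → |τ a - τ b| < l := by
    have main : ∀ a b, G.Adj h a → G.Adj h b → G.Adj a b → τ a ≤ τ b → τ b - τ a < l := by
      intro a b ha hb hab hle
      by_contra hcon
      have na := near a ha
      have nb := near b hb
      have e := (hadj a b hab.ne).1 hab
      rw [abs_sub_comm, abs_of_nonneg (by linarith : 0 ≤ τ b - τ a)] at e
      have e' : 1 - l < τ b - τ a := by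
        rcases e with e | e
        · exact absurd e hcon
        · exact e
      have self : ∀ v, M.Inter v v := by
        intro v; rw [hint]; left; simpa using l0
      have hi : ∀ u v, G.Adj u v → M.Inter u v := fun u v huv => ((hG u v).1 huv).2
      obtain ⟨p, hp⟩ := hH {h, a, b} (by
        intro u hu v hv
        simp only [Set.mem_insert_iff, Set.mem_singleton_iff] at hu hv
        rcases hu with rfl | rfl | rfl <;> rcases hv with rfl | rfl | rfl <;>
          first
          | exact self _
          | exact hi _ _ (by assumption)
          | exact hi _ _ (SimpleGraph.Adj.symm (by assumption)))
      obtain ⟨r, hr, r1, r2⟩ := (hrep.mem_iff l0 l1 h p).1 (hp h (by simp))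
      obtain ⟨s, hs, s1, s2⟩ := (hrep.mem_iff l0 l1 a p).1 (hp a (by simp))
      obtain ⟨t, ht, t1, t2⟩ := (hrep.mem_iff l0 l1 b p).1 (hp b (by simp))
      obtain ⟨i, hi⟩ := (circ_eq_iff _ _).1 (hs.trans hr.symm)
      obtain ⟨j, hj⟩ := (circ_eq_iff _ _).1 (ht.trans hr.symm)
      have i1 : (i : ℝ) < 1 := by linarith
      have i2 : (-1 : ℝ) < i := by linarith
      have j1 : (j : ℝ) < 1 := by linarith
      have j2 : (-1 : ℝ) < j := by linarith
      have i1' : i < 1 := by exact_mod_cast i1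
      have i2' : -1 < i := by exact_mod_cast i2
      have j1' : j < 1 := by exact_mod_cast j1
      have j2' : -1 < j := by exact_mod_cast j2
      obtain rfl : i = 0 := by omega
      obtain rfl : j = 0 := by omega
      push_cast at hi hj
      linarith
    intro a b ha hb hab
    rcases le_total (τ a) (τ b) with hle | hle
    · have := main a b ha hb hab hle
      rw [abs_sub_comm, abs_of_nonneg (by linarith)]; exact this
    · have := main b a hb ha hab.symm hle
      rw [abs_of_nonneg (by linarith)]; exact this
  have far : ∀ a b, a ≠ b → ¬ G.Adj a b → l ≤ |τ a - τ b| := by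
    intro a b hab hn
    rw [hadj a b hab] at hn
    push Not at hn
    exact hn.1
  have q01 := abs_lt.1 (tri _ _ k0 k1 h01)
  have q12 := abs_lt.1 (tri _ _ k1 k2 h12)
  have q23 := abs_lt.1 (tri _ _ k2 k3 h23)
  have q30 := abs_lt.1 (tri _ _ k3 k0 h30)
  have m0 := near _ k0
  have m1 := near _ k1
  have m2 := near _ k2
  have m3 := near _ k3
  rcases le_abs.1 (far _ _ n02 h02) with g | g <;> rcases le_abs.1 (far _ _ n13 h13) with g' | g' <;>
    linarith

lemma uhca_of_no_wheel {V : Type} [Fintype V] {G : SimpleGraph V} (hG : IsUCAGraph G)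
    (hW : IsEmpty (wheel 4 ↪g G)) : IsUHCAGraph G := by
  obtain ⟨M, hM, hG⟩ := hG
  by_cases huniv : ∃ u, ∀ v, v ≠ u → G.Adj u v
  · obtain ⟨u, hu⟩ := huniv
    obtain ⟨l, τ, l0, l1, hrep, hrange, hint, hadj, hcomp⟩ := unit_adj M hM hG u
    obtain ⟨pos, K, hK, hpos⟩ : ∃ (pos : V → ℤ) (K : ℤ), 0 ≤ K ∧
        ∀ a b, a ≠ b → (G.Adj a b ↔ |pos a - pos b| ≤ K) := by
      rcases le_or_gt (1 / 2) l with hl | hl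
      · refine ⟨fun _ => 0, 0, le_rfl, fun a b hab => ?_⟩
        simpa using hcomp hl a b hab
      · have near : ∀ v, -l < τ v - τ u ∧ τ v - τ u < l := by
          intro v
          by_cases hv : v = u
          · subst hv; constructor <;> linarith
          · have := hrange v
            exact close_of_adj hl (by linarith) (by linarith)
              ((hadj v u hv).1 (hu v hv).symm)
        refine chain_repr G hW u hu (fun v => τ v ≤ τ u) ?_ ?_
        · intro a b hab ha hb
          have := near a
          have := near b
          rw [hadj a b hab]
          left; rw [abs_lt]; constructor <;> linarith
        · intro a b hab ha hb
          have := near a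
          have := near b
          rw [not_le] at ha hb
          rw [hadj a b hab]
          left; rw [abs_lt]; constructor <;> linarith
    exact uhca_of_int G pos K hK hpos
  · push Not at huniv
    refine ⟨M, hM, ?_, hG⟩
    intro S hS
    rcases S.eq_empty_or_nonempty with rfl | ⟨a, ha⟩
    · exact ⟨0, by simp⟩
    obtain ⟨l, τ, l0, l1, hrep, hrange, hint, hadj, hcomp⟩ := unit_adj M hM hG a
    have hl : l < 1 / 2 := by
      by_contra hl
      obtain ⟨v, hv, hv'⟩ := huniv a
      exact hv' (hcomp (not_lt.1 hl) _ _ hv.symm)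
    have near : ∀ v ∈ S, -l < τ v - τ a ∧ τ v - τ a < l := by
      intro v hv
      have := hrange v
      exact close_of_adj hl (by linarith) (by linarith) ((hint v a).1 (hS v hv a ha))
    obtain ⟨x, hx, hx'⟩ := Set.exists_min_image S τ S.toFinite ⟨a, ha⟩
    obtain ⟨y, hy, hy'⟩ := Set.exists_max_image S τ S.toFinite ⟨a, ha⟩
    by_cases hxy : τ y - τ x < l
    · refine ⟨(((τ x + l + τ y) / 2 : ℝ) : Circ), fun v hv => ?_⟩
      have h1 := hx' v hv
      have h2 := hy' v hv
      rw [hrep.mem_iff l0 l1]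
      exact ⟨_, rfl, by linarith, by linarith⟩
    · exfalso
      have xa := hx' a ha
      have ya := hy' a ha
      have nx := near x hx
      have ny := near y hy
      have hcov : 1 - l < τ y - τ x := by
        have e := (hint y x).1 (hS y hy x hx)
        rw [abs_of_nonneg (by linarith)] at e
        rcases e with e | e
        · exact absurd e hxy
        · exact e
      obtain ⟨a', na, ka⟩ := huniv a
      obtain ⟨x', nx', kx⟩ := huniv x
      obtain ⟨y', ny', ky⟩ := huniv y
      have ra := hrange a'
      have rx := hrange x'
      have ry := hrange y'
      rw [hadj _ _ na.symm] at ka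
      rw [hadj _ _ nx'.symm] at kx
      rw [hadj _ _ ny'.symm] at ky
      -- adjacency in terms of differences
      have adjI : ∀ u v, (τ u - τ v ≠ 0) → ((-l < τ u - τ v ∧ τ u - τ v < l) ∨ 1 - l < τ u - τ v ∨
          1 - l < τ v - τ u) → G.Adj u v := by
        intro u v h0 h
        have huv : u ≠ v := by rintro rfl; simp at h0
        rw [hadj u v huv]
        rcases h with h | h | h
        · left; exact abs_lt.2 h
        · right; rw [lt_abs]; left; exact h
        · right; rw [lt_abs]; right; linarith
      push Not at ka kx ky
      have bx : τ x + l ≤ τ x' ∧ τ x' ≤ τ x + 1 - l := by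
        have h2 := abs_le.1 kx.2
        rcases le_abs.1 kx.1 with h | h
        · linarith
        · constructor <;> linarith
      have bdy : τ y' ≤ τ y - l ∧ τ y - 1 + l ≤ τ y' := by
        have h2 := abs_le.1 ky.2
        rcases le_abs.1 ky.1 with h | h
        · constructor <;> linarith
        · linarith
      have ba : (τ a + l ≤ τ a' ∧ τ a' ≤ τ a + 1 - l) ∨
          (τ a' ≤ τ a - l ∧ τ a - 1 + l ≤ τ a') := by
        have h2 := abs_le.1 ka.2
        rcases le_abs.1 ka.1 with h | h
        · right; constructor <;> linarith
        · left; constructor <;> linarith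
      have Ka : ¬ G.Adj a a' := by
        rw [hadj _ _ na.symm]; push Not; exact ka
      have Kx : ¬ G.Adj x x' := by
        rw [hadj _ _ nx'.symm]; push Not; exact kx
      have Ky : ¬ G.Adj y y' := by
        rw [hadj _ _ ny'.symm]; push Not; exact ky
      clear ka kx ky
      have Aax : G.Adj a x := adjI _ _ (by intro h; linarith) (by left; constructor <;> linarith)
      have Aay : G.Adj a y := adjI _ _ (by intro h; linarith) (by left; constructor <;> linarith)
      have Axy : G.Adj x y := adjI _ _ (by intro h; linarith) (by right; right; linarith)
      have Aax' : G.Adj a x' := adjI _ _ (by intro h; linarith) (by left; constructor <;> linarith)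
      have Aay' : G.Adj a y' := adjI _ _ (by intro h; linarith) (by left; constructor <;> linarith)
      have Axy' : G.Adj x y' := adjI _ _ (by intro h; linarith) (by left; constructor <;> linarith)
      have Ayx' : G.Adj y x' := adjI _ _ (by intro h; linarith) (by left; constructor <;> linarith)
      have Axa' : G.Adj x a' := by
        rcases ba with ba | ba
        · exact adjI _ _ (by intro h; linarith) (by right; right; linarith)
        · exact adjI _ _ (by intro h; linarith) (by left; constructor <;> linarith)
      have Aya' : G.Adj y a' := by
        rcases ba with ba | ba
        · exact adjI _ _ (by intro h; linarith) (by left; constructor <;> linarith)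
        · exact adjI _ _ (by intro h; linarith) (by right; left; linarith)
      have hsome : G.Adj x' y' ∨ G.Adj a' x' ∨ G.Adj a' y' := by
        by_contra hcon
        push Not at hcon
        obtain ⟨c1, c2, c3⟩ := hcon
        have d1 : l ≤ τ x' - τ y' := by
          by_contra h
          exact c1 (adjI _ _ (by intro h; linarith) (by left; constructor <;> linarith))
        rcases ba with ba | ba
        · have d2 : l ≤ τ a' - τ x' := by
            by_contra h
            exact c2 (adjI _ _ (by intro h; linarith) (by left; constructor <;> linarith))
          exact c3 (adjI _ _ (by intro h; linarith) (by right; left; linarith))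
        · have d2 : l ≤ τ y' - τ a' := by
            by_contra h
            exact c3 (adjI _ _ (by intro h; linarith) (by left; constructor <;> linarith))
          exact c2 (adjI _ _ (by intro h; linarith) (by right; right; linarith))
      rcases hsome with c | c | c
      · obtain ⟨f⟩ := wheel_embed x y x' y' a Axy Ayx' c Axy'.symm Kx Ky nx'.symm ny'.symm
          Aax Aay Aax' Aay'
        exact hW.false f
      · obtain ⟨f⟩ := wheel_embed a x a' x' y Aax Axa' c Aax'.symm Ka Kx na.symm nx'.symm
          Aay.symm Axy.symm Aya' Ayx'
        exact hW.false f
      · obtain ⟨f⟩ := wheel_embed a y a' y' x Aay Aya' c Aay'.symm Ka Ky na.symm ny'.symm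
          Aax.symm Axy Axa' Axy'
        exact hW.false f

/-- A UCA graph is a UHCA graph iff it contains no induced `W_4`. -/
theorem stmt_12 {V : Type} [Fintype V] (G : SimpleGraph V) (hG : IsUCAGraph G) :
    IsUHCAGraph G ↔ IsEmpty (wheel 4 ↪g G) := by
  exact ⟨no_wheel_s12, uhca_of_no_wheel hG⟩
end
end
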